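/- For every graph H, there is a polynomial p such that for every positive integer s, every graph that does not contain the complete bipartite graph K_{s,s} as a subgraph and does not contain an induced subdivision of H has average degree at most p(s). -/

import Mathlib

open SimpleGraph

/-- `G` contains a copy of `H` as a (not necessarily induced) subgraph. -/
def HasSubgraphCopy {V W : Type} (G : SimpleGraph V) (H : SimpleGraph W) : Prop :=
  ∃ f : H →g G, Function.Injective f

/-- `G` contains an induced copy of `H`. -/
def HasInducedCopy {V W : Type} (G : SimpleGraph V) (H : SimpleGraph W) : Prop :=
  ∃ s : Set V, Nonempty ((G.induce s) ≃g H)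

/-- The graph obtained from `G` by subdividing the edge `ab` once (`none` is the new vertex). -/
def edgeSubdiv {V : Type} (G : SimpleGraph V) (a b : V) : SimpleGraph (Option V) :=
  SimpleGraph.fromRel (fun x y =>
    (∃ x' y' : V, x = some x' ∧ y = some y' ∧ G.Adj x' y' ∧
      ¬((x' = a ∧ y' = b) ∨ (x' = b ∧ y' = a))) ∨
    (x = none ∧ (y = some a ∨ y = some b)))

/-- `IsSubdivision H S` : `S` is obtained from `H` by a finite sequence of single edge
subdivisions (edges of `H` get replaced by possibly longer paths). -/
inductive IsSubdivision : {V : Type} → SimpleGraph V → {W : Type} → SimpleGraph W → Prop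
  | refl {V : Type} (G : SimpleGraph V) : IsSubdivision G G
  | step {V W : Type} (G : SimpleGraph V) (H : SimpleGraph W) (a b : W) :
      IsSubdivision G H → H.Adj a b → IsSubdivision G (edgeSubdiv H a b)

/-- `G` contains an induced subdivision of `H`, i.e. some induced subgraph of `G` is
isomorphic to a subdivision of `H`. -/
def HasInducedSubdivision {V W : Type} (G : SimpleGraph V) (H : SimpleGraph W) : Prop :=
  ∃ (U : Type) (S : SimpleGraph U), IsSubdivision H S ∧ HasInducedCopy G S

/-- The average degree `2e(G)/|V(G)|` of a finite graph. -/
noncomputable def avgDeg {V : Type} (G : SimpleGraph V) [Fintype V] : ℝ :=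
  2 * G.edgeSet.ncard / Fintype.card V

section PolyProof
open scoped Classical
open Finset
set_option linter.unusedSectionVars false

variable {V : Type} [Fintype V]

/-- neighbourhood as a finset -/
noncomputable def nb (G : SimpleGraph V) (v : V) : Finset V := univ.filter (G.Adj v)

lemma mem_nb {G : SimpleGraph V} {u v : V} : u ∈ nb G v ↔ G.Adj v u := by simp [nb]

/-- no complete bipartite subgraph, finset form -/
def KFree (s : ℕ) (G : SimpleGraph V) : Prop :=
  ∀ P Q : Finset V, P.card = s → Q.card = s → (∀ x ∈ P, ∀ y ∈ Q, G.Adj x y) → False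

lemma kfree_of_not_copy {s : ℕ} {G : SimpleGraph V}
    (h : ¬ HasSubgraphCopy G (completeBipartiteGraph (Fin s) (Fin s))) : KFree s G := by
  intro P Q hP hQ hPQ
  apply h
  let eP := (Finset.equivFinOfCardEq hP).symm
  let eQ := (Finset.equivFinOfCardEq hQ).symm
  refine ⟨⟨Sum.elim (fun i => (eP i : V)) (fun i => (eQ i : V)), ?_⟩, ?_⟩
  · rintro (a | a) (b | b) hab
    · simp at hab
    · exact hPQ _ (eP a).2 _ (eQ b).2
    · exact (hPQ _ (eP b).2 _ (eQ a).2).symm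
    · simp at hab
  · rintro (a | a) (b | b) hab
    · have : eP a = eP b := Subtype.ext hab
      rw [eP.injective this]
    · exfalso
      have h1 := hPQ _ (eP a).2 _ (eQ b).2
      have h2 : (eP a : V) = eQ b := hab
      rw [h2] at h1
      exact G.irrefl h1
    · exfalso
      have h1 := hPQ _ (eP b).2 _ (eQ a).2
      have h2 : (eQ a : V) = eP b := hab
      rw [h2] at h1
      exact G.irrefl h1
    · have : eQ a = eQ b := Subtype.ext hab
      rw [eQ.injective this]

/-- `x` sees almost all of `W`. -/
def Dom (G : SimpleGraph V) (s : ℕ) (W : Finset V) (x : V) : Prop :=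
  2 * s * (W \ nb G x).card < W.card

lemma dom_card {s : ℕ} (hs : 0 < s) {G : SimpleGraph V} (hK : KFree s G) (W : Finset V)
    (hW : 2 * s ≤ W.card) : (univ.filter (Dom G s W)).card < s := by
  by_contra hcon
  push Not at hcon
  obtain ⟨P, hPsub, hP⟩ := Finset.exists_subset_card_eq hcon
  have hdom : ∀ x ∈ P, 2 * s * (W \ nb G x).card < W.card := by
    intro x hx
    have := hPsub hx
    simpa [Dom] using this
  have hb : (P.biUnion (fun x => W \ nb G x)).card ≤ ∑ x ∈ P, (W \ nb G x).card :=
    Finset.card_biUnion_le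
  have hne : P.Nonempty := by
    rw [← Finset.card_pos, hP]; exact hs
  have hlt : ∑ x ∈ P, 2 * s * (W \ nb G x).card < ∑ x ∈ P, W.card :=
    Finset.sum_lt_sum_of_nonempty hne hdom
  rw [← Finset.mul_sum, Finset.sum_const, hP, smul_eq_mul] at hlt
  have h2 : 2 * (P.biUnion (fun x => W \ nb G x)).card < W.card := by
    have : s * (2 * (P.biUnion (fun x => W \ nb G x)).card) < s * W.card := by
      calc s * (2 * (P.biUnion (fun x => W \ nb G x)).card)
          = 2 * s * (P.biUnion (fun x => W \ nb G x)).card := by ring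
        _ ≤ 2 * s * ∑ x ∈ P, (W \ nb G x).card := Nat.mul_le_mul_left _ hb
        _ < s * W.card := hlt
    exact Nat.lt_of_mul_lt_mul_left this
  have h3 : s ≤ (W \ P.biUnion (fun x => W \ nb G x)).card := by
    have := Finset.le_card_sdiff (P.biUnion (fun x => W \ nb G x)) W
    omega
  obtain ⟨Q, hQsub, hQ⟩ := Finset.exists_subset_card_eq h3
  refine hK P Q hP hQ ?_
  intro x hx y hy
  have := hQsub hy
  simp only [mem_sdiff, mem_biUnion, not_exists, not_and, mem_nb, not_not] at this
  exact this.2 x hx this.1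

/-- independent subsets in `K_{s,s}`-free graphs -/
lemma exists_indep {s : ℕ} (hs : 0 < s) {G : SimpleGraph V} (hK : KFree s G) (h : ℕ) :
    ∀ U : Finset V, (4 * s) ^ h ≤ U.card →
      ∃ T ⊆ U, T.card = h ∧ ∀ x ∈ T, ∀ y ∈ T, ¬ G.Adj x y := by
  induction h with
  | zero => intro U _; exact ⟨∅, by simp, by simp, by simp⟩
  | succ h ih =>
    intro U hU
    have h1 : 1 ≤ (4 * s) ^ h := Nat.one_le_pow _ _ (by omega)
    have hU4 : 4 * s ≤ U.card := by
      rw [pow_succ] at hU; nlinarith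
    have hd := dom_card hs hK U (by omega)
    have : ∃ x ∈ U, ¬ Dom G s U x := by
      by_contra hc
      push Not at hc
      have : U ⊆ univ.filter (Dom G s U) := fun x hx => by simpa using hc x hx
      have := Finset.card_le_card this
      omega
    obtain ⟨x, hx, hxd⟩ := this
    simp only [Dom, not_lt] at hxd
    have hxm : x ∈ U \ nb G x := by simp [mem_nb, hx]
    have hc : ((U \ nb G x).erase x).card + 1 = (U \ nb G x).card := Finset.card_erase_add_one hxm
    have hle : (4 * s) ^ h ≤ ((U \ nb G x).erase x).card := by
      rw [pow_succ] at hU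
      have a1 : (4 * s) ^ h * (4 * s) ≤ 2 * s * (((U \ nb G x).erase x).card + 1) := by
        rw [hc]; exact hU.trans hxd
      have a2 : s * (2 * (4 * s) ^ h) ≤ s * (((U \ nb G x).erase x).card + 1) := by nlinarith
      have a3 := Nat.le_of_mul_le_mul_left a2 hs
      omega
    obtain ⟨T, hTU, hT, hTi⟩ := ih _ hle
    have hTx : ∀ y ∈ T, y ≠ x ∧ y ∈ U ∧ ¬ G.Adj x y := by
      intro y hy
      have := hTU hy
      simpa [mem_nb] using this
    have hxT : x ∉ T := fun hh => (hTx x hh).1 rfl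
    refine ⟨insert x T, ?_, ?_, ?_⟩
    · intro y hy
      rcases Finset.mem_insert.1 hy with rfl | hy
      · exact hx
      · exact (hTx y hy).2.1
    · rw [Finset.card_insert_of_notMem hxT, hT]
    · intro a ha b hb
      rcases Finset.mem_insert.1 ha with ha' | ha' <;>
        rcases Finset.mem_insert.1 hb with hb' | hb'
      · rw [ha', hb']; exact G.irrefl
      · rw [ha']; exact (hTx b hb').2.2
      · rw [hb']; exact fun hh => (hTx a ha').2.2 hh.symm
      · exact hTi a ha' b hb'

lemma exists_reps [Nonempty V] {ι : Type} {s : ℕ} (hs : 0 < s) {G : SimpleGraph V}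
    (hK : KFree s G) (E : Finset ι) : ∀ Y : ι → Finset V,
      (∀ e ∈ E, (2 * s) ^ (E.card + 1) * (E.card + 1) ≤ (Y e).card) →
      ∃ y : ι → V, (∀ e ∈ E, y e ∈ Y e) ∧ ∀ e ∈ E, ∀ f ∈ E, e ≠ f → ¬ G.Adj (y e) (y f) := by
  induction E using Finset.induction_on with
  | empty =>
    intro Y _
    exact ⟨fun _ => Classical.arbitrary V, by simp, by simp⟩
  | insert e0 E he ih =>
    intro Y hY
    rw [Finset.card_insert_of_notMem he] at hY
    set c := E.card with hc
    have hp : 1 ≤ (2 * s) ^ (c + 1) := Nat.one_le_pow _ _ (by omega)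
    have hbig : 2 * s * (c + 2) ≤ (2 * s) ^ (c + 1 + 1) * (c + 1 + 1) := by
      rw [pow_succ]
      calc 2 * s * (c + 2) = 1 * (2 * s) * (c + 1 + 1) := by ring
        _ ≤ (2 * s) ^ (c + 1) * (2 * s) * (c + 1 + 1) := by gcongr
    have hbad : (E.biUnion (fun e => univ.filter (Dom G s (Y e)))).card ≤ c * s := by
      apply Finset.card_biUnion_le_card_mul
      intro e heE
      refine (dom_card hs hK _ ?_).le
      have := hY e (Finset.mem_insert_of_mem heE)
      nlinarith
    have h0 := hY e0 (Finset.mem_insert_self _ _)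
    have : ∃ y0 ∈ Y e0, y0 ∉ E.biUnion (fun e => univ.filter (Dom G s (Y e))) := by
      by_contra hcon
      push Not at hcon
      have := Finset.card_le_card (fun x hx => hcon x hx)
      nlinarith
    obtain ⟨y0, hy0, hy0b⟩ := this
    simp only [mem_biUnion, mem_filter, mem_univ, true_and, not_exists, not_and, Dom,
      not_lt] at hy0b
    obtain ⟨y, hy1, hy2⟩ := ih (fun e => Y e \ nb G y0) (by
      intro e heE
      have h1 := hy0b e heE
      have h2 := hY e (Finset.mem_insert_of_mem heE)
      have h3 : 2 * s * ((2 * s) ^ (c + 1) * (c + 1)) ≤ 2 * s * (Y e \ nb G y0).card := by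
        refine le_trans ?_ (h2.trans h1)
        rw [pow_succ (2 * s) (c + 1)]
        calc 2 * s * ((2 * s) ^ (c + 1) * (c + 1)) = (2 * s) ^ (c + 1) * (2 * s) * (c + 1) := by ring
          _ ≤ _ := by gcongr; omega
      exact Nat.le_of_mul_le_mul_left h3 (by omega))
    refine ⟨Function.update y e0 y0, ?_, ?_⟩
    · intro e heE
      rcases eq_or_ne e e0 with rfl | hne
      · simpa using hy0
      · rw [Function.update_of_ne hne]
        have := hy1 e ((Finset.mem_insert.1 heE).resolve_left hne)
        exact (Finset.mem_sdiff.1 this).1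
    · intro e heE f hfE hef
      have key : ∀ g ∈ insert e0 E, g ≠ e0 → ¬ G.Adj y0 (y g) := by
        intro g hg hne
        have := hy1 g ((Finset.mem_insert.1 hg).resolve_left hne)
        have := (Finset.mem_sdiff.1 this).2
        simpa [mem_nb] using this
      rcases eq_or_ne e e0 with h1 | h1
      · have h2 : f ≠ e0 := fun h => hef (h1.trans h.symm)
        rw [h1, Function.update_self, Function.update_of_ne h2]
        exact key f hfE h2
      · rcases eq_or_ne f e0 with h2 | h2
        · rw [h2, Function.update_self, Function.update_of_ne h1]
          exact fun hh => key e heE h1 hh.symm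
        · rw [Function.update_of_ne h2, Function.update_of_ne h1]
          exact hy2 e ((Finset.mem_insert.1 heE).resolve_left h1) f
            ((Finset.mem_insert.1 hfE).resolve_left h2) hef

/-- an induced 1-subdivision of a graph with at least `k` times as many edges as vertices -/
def OneSub (G : SimpleGraph V) (k : ℕ) : Prop :=
  ∃ A B : Finset V, A.Nonempty ∧ (∀ a ∈ A, ∀ a' ∈ A, ¬ G.Adj a a') ∧
    (∀ b ∈ B, ∀ b' ∈ B, ¬ G.Adj b b') ∧
    (∀ b ∈ B, ∃ a ∈ A, ∃ a' ∈ A, a ≠ a' ∧ ∀ z ∈ A, G.Adj b z ↔ (z = a ∨ z = a')) ∧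
    (∀ b ∈ B, ∀ b' ∈ B, (∀ z ∈ A, G.Adj b z ↔ G.Adj b' z) → b = b') ∧
    k * A.card ≤ B.card

/-- one coordinate counting -/
lemma count_coord {X : Type} [Fintype X] {R : ℕ} (P : (Fin R → X) → Prop)
    [DecidablePred P] (l : Fin R) (c : ℕ)
    (h : ∀ x, (univ.filter fun v => P (Function.update x l v)).card ≤ c) :
    (univ.filter P).card * Fintype.card X ≤ c * Fintype.card X ^ R := by
  have h1 : (univ.filter P).card * Fintype.card X
      = (univ.filter fun q : (Fin R → X) × X => P q.1).card := by
    rw [← Finset.card_univ, ← Finset.card_product]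
    congr 1
    ext q
    simp
  have h2 : (univ.filter fun q : (Fin R → X) × X => P q.1).card
      = (univ.filter fun q : (Fin R → X) × X => P (Function.update q.1 l q.2)).card := by
    refine Finset.card_bij' (fun q _ => (Function.update q.1 l (q.2), q.1 l))
      (fun q _ => (Function.update q.1 l (q.2), q.1 l)) ?_ ?_ ?_ ?_
    · intro q hq; simpa using hq
    · intro q hq; simpa using hq
    · intro q _; simp
    · intro q _; simp
  have h3 : (univ.filter fun q : (Fin R → X) × X => P (Function.update q.1 l q.2)).card
      = ∑ x : Fin R → X, (univ.filter fun v => P (Function.update x l v)).card := by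
    simp_rw [Finset.card_filter]
    rw [← Finset.univ_product_univ, Finset.sum_product]
  rw [h1, h2, h3]
  calc _ ≤ ∑ x : Fin R → X, c := Finset.sum_le_sum (fun x _ => h x)
    _ = _ := by simp [mul_comm]

end PolyProof
section PolyProof
open scoped Classical
open Finset
set_option linter.unusedSectionVars false

variable {V : Type} [Fintype V]

/-- common neighbours -/
noncomputable def cn (G : SimpleGraph V) (a b : V) : Finset V := nb G a ∩ nb G b

/-- common neighbours of `a`, `b` outside of the neighbourhood of `S` -/
noncomputable def cnx (G : SimpleGraph V) (a b : V) (S : Finset V) : Finset V :=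
  (cn G a b).filter (fun y => ∀ z ∈ S, ¬ G.Adj z y)

lemma dense_generic {s : ℕ} (hs : 0 < s) {G : SimpleGraph V} (hK : KFree s G) (X : Finset V)
    (R h M lam : ℕ)
    (hlight : ∀ x ∈ X, (X.filter (fun x' => (cn G x x').card < M)).card ≤ lam)
    (hN : R ^ 2 * (1 + lam) + R ^ 3 * (R + 1) ^ h * s < X.card) :
    ∃ P ⊆ X, P.card = R ∧ (∀ a ∈ P, ∀ b ∈ P, a ≠ b → M ≤ (cn G a b).card) ∧
      ∀ a ∈ P, ∀ b ∈ P, ∀ l ∈ P, l ≠ a → l ≠ b → ∀ S ⊆ P, l ∉ S → S.card ≤ h →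
        2 * s ≤ (cnx G a b S).card → ¬ Dom G s (cnx G a b S) l := by
  let Sg : (Fin h → Option (Fin R)) → Finset (Fin R) :=
    fun g => univ.filter (fun r => ∃ t, g t = some r)
  let E1 : Fin R × Fin R → (Fin R → X) → Prop := fun p x =>
    p.1 ≠ p.2 ∧ (x p.2 = x p.1 ∨ (cn G (x p.1) (x p.2)).card < M)
  let WW : Fin R → Fin R → (Fin h → Option (Fin R)) → (Fin R → X) → Finset V := fun i j g x =>
    cnx G (x i) (x j) ((Sg g).image (fun r => (x r : V)))
  let E2 : (Fin R × Fin R × Fin R × (Fin h → Option (Fin R))) → (Fin R → X) → Prop := fun p x =>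
    (p.2.2.1 ≠ p.1 ∧ p.2.2.1 ≠ p.2.1 ∧ p.2.2.1 ∉ Sg p.2.2.2) ∧
      2 * s ≤ (WW p.1 p.2.1 p.2.2.2 x).card ∧ Dom G s (WW p.1 p.2.1 p.2.2.2 x) (x p.2.2.1)
  have hcX : Fintype.card X = X.card := Fintype.card_coe X
  have c1 : ∀ p, (univ.filter (E1 p)).card * X.card ≤ (1 + lam) * X.card ^ R := by
    intro p
    rw [← hcX]
    apply count_coord _ p.2
    intro x
    by_cases hp : p.1 = p.2
    · simp [E1, hp]
    · have hsub : (univ.filter fun v : X => E1 p (Function.update x p.2 v)) ⊆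
          insert (x p.1) (univ.filter fun v : X => (cn G (x p.1) v).card < M) := by
        intro v hv
        simp only [mem_filter, mem_univ, true_and, E1, Function.update_self,
          Function.update_of_ne hp, mem_insert] at hv ⊢
        exact hv.2
      refine (Finset.card_le_card hsub).trans ((Finset.card_insert_le _ _).trans ?_)
      have : (univ.filter fun v : X => (cn G (x p.1) v).card < M).card ≤ lam := by
        refine le_trans ?_ (hlight (x p.1) (x p.1).2)
        refine Finset.card_le_card_of_injOn (fun v : X => (v : V)) ?_ ?_
        · intro v hv
          simp only [coe_filter, mem_univ, true_and, Set.mem_ofPred_eq] at hv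
          simp [hv]
        · intro a _ b _ hab
          exact Subtype.ext hab
      omega
  have c2 : ∀ p, (univ.filter (E2 p)).card * X.card ≤ s * X.card ^ R := by
    intro p
    rw [← hcX]
    apply count_coord _ p.2.2.1
    intro x
    by_cases hp : p.2.2.1 ≠ p.1 ∧ p.2.2.1 ≠ p.2.1 ∧ p.2.2.1 ∉ Sg p.2.2.2
    · have hW : ∀ v : X, WW p.1 p.2.1 p.2.2.2 (Function.update x p.2.2.1 v)
          = WW p.1 p.2.1 p.2.2.2 x := by
        intro v
        simp only [WW, Function.update_of_ne hp.1.symm, Function.update_of_ne hp.2.1.symm]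
        congr 1
        apply Finset.image_congr
        intro r hr
        have : r ≠ p.2.2.1 := fun h => hp.2.2 (h ▸ hr)
        simp only [Function.update_of_ne this]
      by_cases hcard : 2 * s ≤ (WW p.1 p.2.1 p.2.2.2 x).card
      · refine le_trans ?_ (dom_card hs hK _ hcard).le
        refine Finset.card_le_card_of_injOn (fun v : X => (v : V)) ?_ ?_
        · intro v hv
          simp only [coe_filter, mem_univ, true_and, Set.mem_ofPred_eq, E2, hW,
            Function.update_self] at hv
          simpa using hv.2.2
        · intro a _ b _ hab
          exact Subtype.ext hab
      · rw [Finset.card_eq_zero.2]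
        · exact Nat.zero_le _
        · apply Finset.filter_eq_empty_iff.2
          intro v _ hv
          simp only [E2, hW] at hv
          exact hcard hv.2.1
    · rw [Finset.card_eq_zero.2]
      · exact Nat.zero_le _
      · apply Finset.filter_eq_empty_iff.2
        intro v _ hv
        exact hp hv.1
  have hex : ∃ x : Fin R → X, (∀ p, ¬ E1 p x) ∧ ∀ p, ¬ E2 p x := by
    by_contra hcon
    push Not at hcon
    have hsub : (univ : Finset (Fin R → X)) ⊆
        (univ.biUnion fun p => univ.filter (E1 p)) ∪ (univ.biUnion fun p => univ.filter (E2 p)) := by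
      intro x _
      rw [mem_union]
      by_cases hx : ∀ p, ¬ E1 p x
      · right
        obtain ⟨p, hp⟩ := hcon x hx
        simp only [mem_biUnion, mem_filter, mem_univ, true_and]
        exact ⟨p, hp⟩
      · left
        push Not at hx
        simpa using hx
    have h1 := Finset.card_le_card hsub
    rw [Finset.card_univ, Fintype.card_fun, hcX, Fintype.card_fin] at h1
    have h2 := h1.trans (Finset.card_union_le _ _)
    have h3 : (univ.biUnion fun p => univ.filter (E1 p)).card ≤ ∑ p, (univ.filter (E1 p)).card :=
      Finset.card_biUnion_le
    have h4 : (univ.biUnion fun p => univ.filter (E2 p)).card ≤ ∑ p, (univ.filter (E2 p)).card :=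
      Finset.card_biUnion_le
    have h5 : (∑ p, (univ.filter (E1 p)).card) * X.card ≤ R ^ 2 * ((1 + lam) * X.card ^ R) := by
      rw [Finset.sum_mul]
      refine (Finset.sum_le_sum (fun p _ => c1 p)).trans ?_
      rw [Finset.sum_const, Finset.card_univ, smul_eq_mul]
      simp [pow_two]
    have h6 : (∑ p, (univ.filter (E2 p)).card) * X.card ≤
        R ^ 3 * (R + 1) ^ h * (s * X.card ^ R) := by
      rw [Finset.sum_mul]
      refine (Finset.sum_le_sum (fun p _ => c2 p)).trans ?_
      rw [Finset.sum_const, Finset.card_univ, smul_eq_mul]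
      simp only [Fintype.card_prod, Fintype.card_fun, Fintype.card_fin, Fintype.card_option]
      apply le_of_eq; ring
    have hpos : 0 < X.card ^ R := Nat.pow_pos (by omega)
    have h7 : X.card ^ R * X.card ≤
        (R ^ 2 * (1 + lam) + R ^ 3 * (R + 1) ^ h * s) * X.card ^ R := by
      calc X.card ^ R * X.card ≤ (∑ p, (univ.filter (E1 p)).card
            + ∑ p, (univ.filter (E2 p)).card) * X.card := by gcongr; omega
        _ ≤ _ := by rw [add_mul]; nlinarith
    have h8 : (R ^ 2 * (1 + lam) + R ^ 3 * (R + 1) ^ h * s) * X.card ^ R < X.card * X.card ^ R :=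
      Nat.mul_lt_mul_of_pos_right hN hpos
    nlinarith
  obtain ⟨x, hx1, hx2⟩ := hex
  have hinj : Function.Injective (fun r => (x r : V)) := by
    intro a b hab
    by_contra hne
    exact hx1 (a, b) ⟨hne, Or.inl (Subtype.ext hab.symm)⟩
  refine ⟨univ.image (fun r => (x r : V)), ?_, ?_, ?_, ?_⟩
  · intro v hv
    obtain ⟨r, _, rfl⟩ := Finset.mem_image.1 hv
    exact (x r).2
  · rw [Finset.card_image_of_injective _ hinj]; simp
  · intro a ha b hb hab
    obtain ⟨i, _, rfl⟩ := Finset.mem_image.1 ha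
    obtain ⟨j, _, rfl⟩ := Finset.mem_image.1 hb
    by_contra hlt
    push Not at hlt
    exact hx1 (i, j) ⟨fun h => hab (by simp only at h; rw [h]), Or.inr hlt⟩
  · intro a ha b hb l hl hla hlb S hS hlS hSc hW hD
    obtain ⟨i, _, rfl⟩ := Finset.mem_image.1 ha
    obtain ⟨j, _, rfl⟩ := Finset.mem_image.1 hb
    obtain ⟨m, _, rfl⟩ := Finset.mem_image.1 hl
    let S' : Finset (Fin R) := univ.filter (fun r => (x r : V) ∈ S)
    have hS' : S'.image (fun r => (x r : V)) = S := by
      ext v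
      simp only [S', mem_image, mem_filter, mem_univ, true_and]
      constructor
      · rintro ⟨r, hr, rfl⟩; exact hr
      · intro hv
        obtain ⟨r, _, rfl⟩ := Finset.mem_image.1 (hS hv)
        exact ⟨r, hv, rfl⟩
    have hS'c : S'.card ≤ h := by
      rw [← Finset.card_image_of_injective S' hinj, hS']; exact hSc
    let g : Fin h → Option (Fin R) := fun t => S'.toList[t.val]?
    have hg : Sg g = S' := by
      ext r
      simp only [Sg, g, mem_filter, mem_univ, true_and]
      rw [← Finset.mem_toList, List.mem_iff_getElem?]
      constructor
      · rintro ⟨t, ht⟩; exact ⟨t, ht⟩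
      · rintro ⟨t, ht⟩
        have : t < S'.toList.length := by
          by_contra hcon
          rw [List.getElem?_eq_none (by omega)] at ht
          simp at ht
        rw [Finset.length_toList] at this
        exact ⟨⟨t, by omega⟩, ht⟩
    refine hx2 (i, j, m, g) ⟨⟨?_, ?_, ?_⟩, ?_, ?_⟩
    · rintro h; exact hla (by simp only at h; rw [h])
    · rintro h; exact hlb (by simp only at h; rw [h])
    · simp only [hg]
      intro hm
      exact hlS (by simpa [S'] using hm)
    · simp only [WW, hg, hS']; exact hW
    · simp only [WW, hg, hS']; exact hD

end PolyProof
section PolyProof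
open scoped Classical
open Finset
set_option linter.unusedSectionVars false

variable {V : Type} [Fintype V]

/-- parameter: size of the generic set -/
def RR (s k : ℕ) : ℕ := (4 * s) ^ (2 * k + 1)

/-- parameter: codegree threshold -/
def MM (s k : ℕ) : ℕ :=
  (2 * s) ^ (2 * k + 1) * ((2 * s) ^ ((2 * k + 1) * k + 1) * ((2 * k + 1) * k + 1))

/-- parameter: genericity -/
def GG (s k : ℕ) : ℕ := RR s k ^ 2 + RR s k ^ 3 * (RR s k + 1) ^ (2 * k + 1) * s

lemma cnx_large {s k M : ℕ} (hs : 0 < s) {G : SimpleGraph V} (P : Finset V) (a b : V)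
    (h : ℕ) (hM : M ≤ (cn G a b).card) (hM2 : (2 * s) ^ h * (2 * s) ≤ M)
    (hP : ∀ l ∈ P, l ≠ a → l ≠ b → ∀ S ⊆ P, l ∉ S → S.card ≤ h →
        2 * s ≤ (cnx G a b S).card → ¬ Dom G s (cnx G a b S) l) (S : Finset V) :
    S ⊆ P → a ∉ S → b ∉ S → S.card ≤ h → M ≤ (2 * s) ^ S.card * (cnx G a b S).card := by
  induction S using Finset.induction_on with
  | empty =>
    intro _ _ _ _
    simpa [cnx] using hM
  | insert l S hl ih =>
    intro hSP ha hb hc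
    rw [Finset.card_insert_of_notMem hl] at hc ⊢
    have hSP' : S ⊆ P := fun x hx => hSP (Finset.mem_insert_of_mem hx)
    have h1 := ih hSP' (fun h => ha (Finset.mem_insert_of_mem h))
      (fun h => hb (Finset.mem_insert_of_mem h)) (by omega)
    have hW : 2 * s ≤ (cnx G a b S).card := by
      have h2 : (2 * s) ^ S.card * (2 * s) ≤ (2 * s) ^ S.card * (cnx G a b S).card := by
        refine le_trans ?_ (hM2.trans h1)
        exact Nat.mul_le_mul_right _ (Nat.pow_le_pow_right (by omega) (by omega))
      exact Nat.le_of_mul_le_mul_left h2 (Nat.pow_pos (by omega))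
    have hD := hP l (hSP (Finset.mem_insert_self _ _))
      (fun h => ha (h ▸ Finset.mem_insert_self _ _))
      (fun h => hb (h ▸ Finset.mem_insert_self _ _)) S hSP' hl (by omega) hW
    simp only [Dom, not_lt] at hD
    have heq : cnx G a b (insert l S) = cnx G a b S \ nb G l := by
      ext y
      simp only [cnx, mem_filter, mem_insert, mem_sdiff, mem_nb]
      constructor
      · rintro ⟨h1, h2⟩
        exact ⟨⟨h1, fun z hz => h2 z (Or.inr hz)⟩, h2 l (Or.inl rfl)⟩
      · rintro ⟨⟨h1, h2⟩, h3⟩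
        refine ⟨h1, ?_⟩
        rintro z (rfl | hz)
        · exact h3
        · exact h2 z hz
    rw [heq, pow_succ]
    calc M ≤ (2 * s) ^ S.card * (cnx G a b S).card := h1
      _ ≤ (2 * s) ^ S.card * (2 * s * (cnx G a b S \ nb G l).card) := Nat.mul_le_mul_left _ hD
      _ = _ := by ring

lemma dense_win {s k : ℕ} (hs : 0 < s) {G : SimpleGraph V} (hK : KFree s G) (X : Finset V)
    (M lam : ℕ) (hM : MM s k ≤ M)
    (hlight : ∀ x ∈ X, (X.filter (fun x' => (cn G x x').card < M)).card ≤ lam)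
    (hN : RR s k ^ 2 * lam + GG s k < X.card) : OneSub G k := by
  obtain ⟨P, hPX, hPc, hP1, hP2⟩ := dense_generic hs hK X (RR s k) (2 * k + 1) M lam hlight
    (by unfold GG at hN; nlinarith)
  obtain ⟨T, hTP, hTc, hTi⟩ := exists_indep hs hK (2 * k + 1) P (by rw [hPc]; exact le_rfl)
  have hTne : T.Nonempty := by rw [← Finset.card_pos]; omega
  have hVne : Nonempty V := ⟨hTne.choose⟩
  set q := (2 * k + 1) * k with hq
  have hEc : (T.powersetCard 2).card = q := by
    rw [Finset.card_powersetCard, hTc, Nat.choose_two_right, hq]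
    apply Nat.div_eq_of_eq_mul_left (by norm_num)
    rw [Nat.add_sub_cancel]; ring
  have hp : 1 ≤ (2 * s) ^ q := Nat.one_le_pow _ _ (by omega)
  have hbig : 2 * s ≤ (2 * s) ^ (q + 1) * (q + 1) := by
    rw [pow_succ]
    calc 2 * s = 1 * (2 * s) * 1 := by ring
      _ ≤ (2 * s) ^ q * (2 * s) * (q + 1) := by gcongr; omega
  obtain ⟨y, hy1, hy2⟩ := exists_reps hs hK (T.powersetCard 2)
    (fun e => univ.filter (fun y => ∀ z ∈ T, G.Adj y z ↔ z ∈ e)) (by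
      intro e he
      rw [hEc]
      obtain ⟨heT, hec⟩ := Finset.mem_powersetCard.1 he
      obtain ⟨a, b, hab, rfl⟩ := Finset.card_eq_two.1 hec
      have haT : a ∈ T := heT (by simp)
      have hbT : b ∈ T := heT (by simp)
      have hSc : (T \ {a, b}).card ≤ 2 * k + 1 := by
        rw [← hTc]; exact Finset.card_le_card Finset.sdiff_subset
      have hl := cnx_large (k := k) hs P a b (2 * k + 1) (hP1 a (hTP haT) b (hTP hbT) hab)
        (by
          refine le_trans ?_ hM
          unfold MM
          exact Nat.mul_le_mul_left _ hbig)
        (hP2 a (hTP haT) b (hTP hbT)) (T \ {a, b})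
        (fun x hx => hTP (Finset.mem_sdiff.1 hx).1) (by simp) (by simp) hSc
      have h1 : (2 * s) ^ (2 * k + 1) * ((2 * s) ^ (q + 1) * (q + 1)) ≤
          (2 * s) ^ (2 * k + 1) * (cnx G a b (T \ {a, b})).card := by
        refine (hM.trans hl).trans ?_
        exact Nat.mul_le_mul_right _ (Nat.pow_le_pow_right (by omega) hSc)
      refine (Nat.le_of_mul_le_mul_left h1 (Nat.pow_pos (by omega))).trans ?_
      apply Finset.card_le_card
      intro w hw
      simp only [cnx, cn, mem_filter, mem_inter, mem_nb, mem_sdiff, mem_insert, mem_singleton,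
        not_or, mem_univ, true_and] at hw ⊢
      intro z hz
      constructor
      · intro hwz
        by_contra hne
        push Not at hne
        exact hw.2 z ⟨hz, hne.1, hne.2⟩ hwz.symm
      · rintro (rfl | rfl)
        · exact hw.1.1.symm
        · exact hw.1.2.symm)
  have hy1' : ∀ e ∈ T.powersetCard 2, ∀ z ∈ T, G.Adj (y e) z ↔ z ∈ e := by
    intro e he
    simpa using hy1 e he
  have hsep : ∀ e ∈ T.powersetCard 2, ∀ f ∈ T.powersetCard 2,
      (∀ z ∈ T, G.Adj (y e) z ↔ G.Adj (y f) z) → e = f := by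
    intro e he f hf hef
    ext z
    constructor
    · intro hz
      have hzT := (Finset.mem_powersetCard.1 he).1 hz
      exact (hy1' f hf z hzT).1 ((hef z hzT).1 ((hy1' e he z hzT).2 hz))
    · intro hz
      have hzT := (Finset.mem_powersetCard.1 hf).1 hz
      exact (hy1' e he z hzT).1 ((hef z hzT).2 ((hy1' f hf z hzT).2 hz))
  refine ⟨T, (T.powersetCard 2).image y, hTne, hTi, ?_, ?_, ?_, ?_⟩
  · intro b hb b' hb'
    obtain ⟨e, he, rfl⟩ := Finset.mem_image.1 hb
    obtain ⟨f, hf, rfl⟩ := Finset.mem_image.1 hb'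
    by_cases hef : e = f
    · rw [hef]; exact G.irrefl
    · exact hy2 e he f hf hef
  · intro b hb
    obtain ⟨e, he, rfl⟩ := Finset.mem_image.1 hb
    obtain ⟨heT, hec⟩ := Finset.mem_powersetCard.1 he
    obtain ⟨a, b, hab, rfl⟩ := Finset.card_eq_two.1 hec
    refine ⟨a, heT (by simp), b, heT (by simp), hab, ?_⟩
    intro z hz
    rw [hy1' _ he z hz]; simp
  · intro b hb b' hb' hbb
    obtain ⟨e, he, rfl⟩ := Finset.mem_image.1 hb
    obtain ⟨f, hf, rfl⟩ := Finset.mem_image.1 hb'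
    rw [hsep e he f hf hbb]
  · rw [Finset.card_image_of_injOn, hEc, hTc, hq, mul_comm]
    intro e he f hf hef
    exact hsep e he f hf (fun z _ => by rw [hef])

/-- ordered pairs of `X` of small codegree -/
noncomputable def lightP (G : SimpleGraph V) (M : ℕ) (X : Finset V) : Finset (V × V) :=
  (X ×ˢ X).filter (fun p => (cn G p.1 p.2).card < M)

lemma mem_cn {G : SimpleGraph V} {a b y : V} : y ∈ cn G a b ↔ G.Adj a y ∧ G.Adj b y := by
  simp [cn, mem_nb]

lemma mem_lightP {G : SimpleGraph V} {M : ℕ} {X : Finset V} {p : V × V} :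
    p ∈ lightP G M X ↔ (p.1 ∈ X ∧ p.2 ∈ X) ∧ (cn G p.1 p.2).card < M := by
  simp [lightP]

lemma dense_total {s k : ℕ} (hs : 0 < s) {G : SimpleGraph V} (hK : KFree s G) (X : Finset V)
    (M : ℕ) (hM : MM s k ≤ M) (hl : 8 * RR s k ^ 2 * (lightP G M X).card ≤ X.card ^ 2)
    (hN : 4 * GG s k < X.card) : OneSub G k := by
  set R := RR s k with hR
  set N := X.card with hNdef
  have hRpos : 0 < R := Nat.pow_pos (by omega)
  let f : V → ℕ := fun x => (X.filter (fun x' => (cn G x x').card < M)).card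
  have hsum : (lightP G M X).card = ∑ x ∈ X, f x := by
    unfold lightP
    rw [Finset.card_filter, Finset.sum_product]
    apply Finset.sum_congr rfl
    intro x _
    simp only [f]
    rw [Finset.card_filter]
  let X' := X.filter (fun x => 4 * R ^ 2 * f x ≤ N)
  have hX' : N ≤ 2 * X'.card := by
    have h1 : X'.card + (X.filter (fun x => ¬ 4 * R ^ 2 * f x ≤ N)).card = N :=
      Finset.card_filter_add_card_filter_not _
    have h2 : (X.filter (fun x => ¬ 4 * R ^ 2 * f x ≤ N)).card * N ≤
        ∑ x ∈ X, 4 * R ^ 2 * f x := by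
      calc _ = ∑ x ∈ X.filter (fun x => ¬ 4 * R ^ 2 * f x ≤ N), N := by
            rw [Finset.sum_const, smul_eq_mul]
        _ ≤ ∑ x ∈ X.filter (fun x => ¬ 4 * R ^ 2 * f x ≤ N), 4 * R ^ 2 * f x := by
            apply Finset.sum_le_sum
            intro x hx
            have := (Finset.mem_filter.1 hx).2
            omega
        _ ≤ _ := Finset.sum_le_sum_of_subset (Finset.filter_subset _ _)
    rw [← Finset.mul_sum, ← hsum] at h2
    have h3 : 2 * (X.filter (fun x => ¬ 4 * R ^ 2 * f x ≤ N)).card * N ≤ N * N := by nlinarith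
    have h4 := Nat.le_of_mul_le_mul_right h3 (by omega)
    omega
  refine dense_win hs hK X' M (N / (4 * R ^ 2)) hM ?_ ?_
  · intro x hx
    obtain ⟨_, hx2⟩ := Finset.mem_filter.1 hx
    refine le_trans (Finset.card_le_card (Finset.filter_subset_filter _ (Finset.filter_subset _ _)))
      ?_
    rw [Nat.le_div_iff_mul_le (by positivity)]
    calc _ = 4 * R ^ 2 * f x := by ring
      _ ≤ N := hx2
  · have : 4 * R ^ 2 * (N / (4 * R ^ 2)) ≤ N := Nat.mul_div_le _ _
    rw [← hR]
    nlinarith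

/-- twice the number of edges inside `S` -/
noncomputable def ee (G : SimpleGraph V) (S : Finset V) : ℕ := ∑ v ∈ S, (S ∩ nb G v).card

lemma dense_edges {s k : ℕ} (hs : 0 < s) {G : SimpleGraph V} (hK : KFree s G) (X : Finset V)
    (Eps : ℕ) (hE : X.card ^ 2 ≤ Eps * ee G X) (hE0 : 0 < Eps)
    (hN : Eps ^ 2 * (8 * RR s k ^ 2 * MM s k + 16 * GG s k ^ 2 + 1) ≤ X.card) : OneSub G k := by
  set R := RR s k with hR
  set N := X.card with hNdef
  let U : V → Finset V := fun y => X ∩ nb G y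
  -- sum of squares
  have hCS : ee G X ^ 2 ≤ N * ∑ y ∈ X, (U y).card ^ 2 := by
    have := sq_sum_le_card_mul_sum_sq (s := X) (f := fun y => (U y).card)
    simpa [ee] using this
  have hL : ∑ y ∈ X, (lightP G (MM s k) (U y)).card ≤ N ^ 2 * MM s k := by
    have h1 : ∀ y ∈ X, (lightP G (MM s k) (U y)).card =
        ∑ p ∈ lightP G (MM s k) X, if y ∈ cn G p.1 p.2 then 1 else 0 := by
      intro y _
      rw [← Finset.card_filter]
      congr 1
      ext p
      simp only [mem_filter, mem_lightP, U, mem_cn, mem_inter, mem_nb]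
      constructor
      · rintro ⟨⟨⟨h1, h2⟩, h3, h4⟩, h5⟩
        exact ⟨⟨⟨h1, h3⟩, h5⟩, h2.symm, h4.symm⟩
      · rintro ⟨⟨⟨h1, h3⟩, h5⟩, h2, h4⟩
        exact ⟨⟨⟨h1, h2.symm⟩, h3, h4.symm⟩, h5⟩
    rw [Finset.sum_congr rfl h1, Finset.sum_comm]
    calc _ ≤ ∑ p ∈ lightP G (MM s k) X, MM s k := by
          apply Finset.sum_le_sum
          intro p hp
          rw [← Finset.card_filter]
          refine le_trans (Finset.card_le_card ?_) (Finset.mem_filter.1 hp).2.le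
          intro y hy
          exact (Finset.mem_filter.1 hy).2
      _ = (lightP G (MM s k) X).card * MM s k := by rw [Finset.sum_const, smul_eq_mul]
      _ ≤ _ := by
          apply Nat.mul_le_mul_right
          refine (Finset.card_filter_le _ _).trans ?_
          rw [Finset.card_product, pow_two]
  have hNpos : 0 < N := lt_of_lt_of_le (by positivity) hN
  have hex : ∃ y ∈ X, 8 * R ^ 2 * (lightP G (MM s k) (U y)).card + 16 * GG s k ^ 2
      < (U y).card ^ 2 := by
    by_contra hcon
    push Not at hcon
    have h1 := Finset.sum_le_sum hcon
    rw [Finset.sum_add_distrib, ← Finset.mul_sum, Finset.sum_const, smul_eq_mul] at h1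
    have h2 : N ^ 2 * N ^ 2 ≤ Eps ^ 2 * ee G X ^ 2 := by
      calc N ^ 2 * N ^ 2 ≤ (Eps * ee G X) * (Eps * ee G X) := Nat.mul_le_mul hE hE
        _ = _ := by ring
    have h3 : N ^ 2 * N ^ 2 ≤ Eps ^ 2 * (N * (8 * R ^ 2 * (N ^ 2 * MM s k)
        + N * (16 * GG s k ^ 2))) := by
      refine h2.trans (Nat.mul_le_mul_left _ (hCS.trans (Nat.mul_le_mul_left _ (h1.trans ?_))))
      exact Nat.add_le_add_right (Nat.mul_le_mul_left _ hL) _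
    have h4 : Eps ^ 2 * (N * (8 * R ^ 2 * (N ^ 2 * MM s k) + N * (16 * GG s k ^ 2))) <
        N ^ 2 * N ^ 2 := by
      have h5 : N * (16 * GG s k ^ 2) ≤ N ^ 2 * (16 * GG s k ^ 2) := by
        apply Nat.mul_le_mul_right; nlinarith
      calc _ ≤ Eps ^ 2 * (N * (8 * R ^ 2 * (N ^ 2 * MM s k) + N ^ 2 * (16 * GG s k ^ 2))) := by
            gcongr
        _ = (Eps ^ 2 * (8 * R ^ 2 * MM s k + 16 * GG s k ^ 2)) * N ^ 3 := by ring
        _ < (Eps ^ 2 * (8 * R ^ 2 * MM s k + 16 * GG s k ^ 2 + 1)) * N ^ 3 := by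
            apply Nat.mul_lt_mul_of_pos_right _ (by positivity)
            apply Nat.mul_lt_mul_of_pos_left (by omega) (by positivity)
        _ ≤ N * N ^ 3 := Nat.mul_le_mul_right _ hN
        _ = _ := by ring
    omega
  obtain ⟨y, hy, hlt⟩ := hex
  refine dense_total hs hK (U y) (MM s k) le_rfl ?_ ?_
  · rw [← hR]; omega
  · by_contra hcon
    push Not at hcon
    have : (U y).card ^ 2 ≤ (4 * GG s k) ^ 2 := Nat.pow_le_pow_left hcon 2
    nlinarith

end PolyProof
section PolyProof
open scoped Classical
open Finset
set_option linter.unusedSectionVars false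

variable {V : Type} [Fintype V]

/-- expectation over a random subset, each vertex taken with probability `1/m` -/
noncomputable def EX (m : ℕ) (f : Finset V → ℝ) : ℝ :=
  (∑ ω : V → Fin m, f (univ.filter (fun v => (ω v).val = 0))) / (m : ℝ) ^ (Fintype.card V)

lemma EX_add (m : ℕ) (f g : Finset V → ℝ) :
    EX m (fun A => f A + g A) = EX m f + EX m g := by
  simp [EX, Finset.sum_add_distrib, add_div]

lemma EX_sub (m : ℕ) (f g : Finset V → ℝ) :
    EX m (fun A => f A - g A) = EX m f - EX m g := by
  simp [EX, Finset.sum_sub_distrib, sub_div]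

lemma EX_mul (m : ℕ) (c : ℝ) (f : Finset V → ℝ) :
    EX m (fun A => c * f A) = c * EX m f := by
  simp [EX, ← Finset.mul_sum, mul_div_assoc]

lemma EX_sum (m : ℕ) {ι : Type} (S : Finset ι) (f : ι → Finset V → ℝ) :
    EX m (fun A => ∑ i ∈ S, f i A) = ∑ i ∈ S, EX m (f i) := by
  simp only [EX]
  rw [Finset.sum_comm, Finset.sum_div]

lemma EX_mono (m : ℕ) {f g : Finset V → ℝ} (h : ∀ A, f A ≤ g A) : EX m f ≤ EX m g := by
  unfold EX
  apply div_le_div_of_nonneg_right _ (by positivity)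
  exact Finset.sum_le_sum fun ω _ => h _

lemma EX_pos (m : ℕ) {f : Finset V → ℝ} (h : 0 < EX m f) : ∃ A, 0 < f A := by
  by_contra hc
  push Not at hc
  have := EX_mono m hc
  have h0 : EX m (fun _ : Finset V => (0 : ℝ)) = 0 := by simp [EX]
  linarith

/-- indicator of `S ⊆ A` -/
noncomputable def ind (S A : Finset V) : ℝ := if S ⊆ A then 1 else 0

lemma ind_nonneg (S A : Finset V) : 0 ≤ ind S A := by
  unfold ind; split_ifs <;> norm_num

lemma ind_le_one (S A : Finset V) : ind S A ≤ 1 := by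
  unfold ind; split_ifs <;> norm_num

lemma EX_ind (m : ℕ) (hm : 0 < m) (S : Finset V) : EX m (ind S) = (1 / (m : ℝ)) ^ S.card := by
  unfold EX ind
  rw [Finset.sum_boole]
  have : (univ.filter fun ω : V → Fin m => S ⊆ univ.filter (fun v => (ω v).val = 0)) =
      Fintype.piFinset (fun v => if v ∈ S then {(⟨0, hm⟩ : Fin m)} else univ) := by
    ext ω
    simp only [mem_filter, mem_univ, true_and, Fintype.mem_piFinset, Finset.subset_iff]
    constructor
    · intro h v
      split_ifs with hv
      · simpa [Fin.ext_iff] using h hv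
      · simp
    · intro h v hv
      have := h v
      rw [if_pos hv] at this
      simpa [Fin.ext_iff] using this
  rw [this, Fintype.card_piFinset]
  have h2 : ∏ v : V, (if v ∈ S then {(⟨0, hm⟩ : Fin m)} else univ : Finset (Fin m)).card
      = m ^ (univ \ S).card := by
    have : ∀ v : V, (if v ∈ S then {(⟨0, hm⟩ : Fin m)} else univ : Finset (Fin m)).card
        = if v ∈ univ \ S then m else 1 := by
      intro v
      by_cases hv : v ∈ S <;> simp [hv]
    rw [Finset.prod_congr rfl fun v _ => this v, Finset.prod_ite_mem]
    simp
  rw [h2]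
  have h3 : (univ \ S).card + S.card = Fintype.card V := by
    rw [Finset.card_sdiff_add_card_eq_card (Finset.subset_univ S), Finset.card_univ]
  have hm' : (m : ℝ) ≠ 0 := by positivity
  rw [← h3, pow_add]
  push_cast
  rw [one_div, inv_pow]
  field_simp

/-- orientation with bounded out-degree -/
lemma exists_orient (G : SimpleGraph V) (d : ℕ)
    (h : ∀ T : Finset V, T.Nonempty → ∃ v ∈ T, (T ∩ nb G v).card ≤ d) (T : Finset V) :
    ∃ Out : V → Finset V, (∀ v ∈ T, Out v ⊆ nb G v ∧ (Out v).card ≤ d) ∧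
      ∀ u ∈ T, ∀ v ∈ T, G.Adj u v → v ∈ Out u ∨ u ∈ Out v := by
  induction T using Finset.strongInduction with
  | H T ih =>
    rcases T.eq_empty_or_nonempty with rfl | hT
    · exact ⟨fun _ => ∅, by simp, by simp⟩
    obtain ⟨v, hv, hvd⟩ := h T hT
    obtain ⟨Out, h1, h2⟩ := ih (T.erase v) (Finset.erase_ssubset hv)
    refine ⟨Function.update Out v (T ∩ nb G v), ?_, ?_⟩
    · intro u hu
      by_cases huv : u = v
      · subst huv
        simp only [Function.update_self]
        exact ⟨Finset.inter_subset_right, hvd⟩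
      · rw [Function.update_of_ne huv]
        exact h1 u (Finset.mem_erase.2 ⟨huv, hu⟩)
    · intro u hu w hw huw
      by_cases huv : u = v
      · subst huv
        left
        simp [hw, mem_nb, huw]
      · by_cases hwv : w = v
        · subst hwv
          right
          simp [hu, mem_nb, huw.symm]
        · rw [Function.update_of_ne huv, Function.update_of_ne hwv]
          exact h2 u (Finset.mem_erase.2 ⟨huv, hu⟩) w (Finset.mem_erase.2 ⟨hwv, hw⟩) huw

lemma card_low (G : SimpleGraph V) (d : ℕ) (hd : 0 < d) (Out : V → Finset V)
    (h1 : ∀ v, (Out v).card ≤ d) (h2 : ∀ u v, G.Adj u v → v ∈ Out u ∨ u ∈ Out v) :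
    Fintype.card V ≤ 2 * (univ.filter fun v => (nb G v).card ≤ 4 * d).card := by
  have hs : ∑ v : V, (nb G v).card ≤ 2 * (d * Fintype.card V) := by
    calc ∑ v : V, (nb G v).card
        ≤ ∑ v : V, ∑ u : V, ((if u ∈ Out v then 1 else 0) + (if v ∈ Out u then 1 else 0)) := by
          apply Finset.sum_le_sum
          intro v _
          unfold nb
          rw [Finset.card_filter]
          apply Finset.sum_le_sum
          intro u _
          by_cases huv : G.Adj v u
          · rcases h2 v u huv with h | h <;> simp [huv, h]
          · simp [huv]
      _ = ∑ v : V, (Out v).card + ∑ u : V, (Out u).card := by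
          simp only [Finset.sum_add_distrib]
          congr 1
          · simp
          · rw [Finset.sum_comm]; simp
      _ ≤ ∑ v : V, d + ∑ u : V, d :=
          Nat.add_le_add (Finset.sum_le_sum fun v _ => h1 v) (Finset.sum_le_sum fun v _ => h1 v)
      _ = _ := by simp; ring
  have h3 : (univ.filter fun v => (nb G v).card ≤ 4 * d).card +
      (univ.filter fun v => ¬ (nb G v).card ≤ 4 * d).card = Fintype.card V := by
    rw [Finset.card_filter_add_card_filter_not, Finset.card_univ]
  have h4 : (univ.filter fun v => ¬ (nb G v).card ≤ 4 * d).card * (4 * d) ≤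
      ∑ v : V, (nb G v).card := by
    calc _ = ∑ v ∈ univ.filter (fun v => ¬ (nb G v).card ≤ 4 * d), 4 * d := by
          rw [Finset.sum_const, smul_eq_mul]
      _ ≤ ∑ v ∈ univ.filter (fun v => ¬ (nb G v).card ≤ 4 * d), (nb G v).card := by
          apply Finset.sum_le_sum
          intro v hv
          have := (Finset.mem_filter.1 hv).2
          omega
      _ ≤ _ := Finset.sum_le_sum_of_subset (Finset.filter_subset _ _)
  have h5 : d * (2 * (univ.filter fun v => ¬ (nb G v).card ≤ 4 * d).card) ≤
      d * Fintype.card V := by nlinarith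
  have h6 := Nat.le_of_mul_le_mul_left h5 hd
  omega

/-- weak Turán -/
lemma weak_turan {β : Type} (B : Finset β) (C : β → β → Prop) (hsym : ∀ a b, C a b → C b a)
    (τ : ℝ) (hτ : 0 < τ)
    (h : ∑ b ∈ B, ((B.filter fun b' => C b b').card : ℝ) ≤ τ * B.card) :
    ∃ I ⊆ B, (∀ a ∈ I, ∀ b ∈ I, C a b → a = b) ∧ (B.card : ℝ) ≤ 2 * (1 + 2 * τ) * I.card := by
  let dg : β → ℝ := fun b => ((B.filter fun b' => C b b').card : ℝ)
  let B1 := B.filter fun b => dg b ≤ 2 * τ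
  have hB1 : (B.card : ℝ) ≤ 2 * B1.card := by
    have h3 : B1.card + (B.filter fun b => ¬ dg b ≤ 2 * τ).card = B.card :=
      Finset.card_filter_add_card_filter_not _
    have h4 : ((B.filter fun b => ¬ dg b ≤ 2 * τ).card : ℝ) * (2 * τ) ≤ ∑ b ∈ B, dg b := by
      calc _ = ∑ b ∈ B.filter (fun b => ¬ dg b ≤ 2 * τ), (2 * τ) := by
            rw [Finset.sum_const, nsmul_eq_mul]
        _ ≤ ∑ b ∈ B.filter (fun b => ¬ dg b ≤ 2 * τ), dg b := by
            apply Finset.sum_le_sum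
            intro v hv
            have := (Finset.mem_filter.1 hv).2
            push Not at this
            exact this.le
        _ ≤ _ := Finset.sum_le_sum_of_subset_of_nonneg (Finset.filter_subset _ _)
            (fun b _ _ => Nat.cast_nonneg _)
    have h5 : (B1.card : ℝ) + (B.filter fun b => ¬ dg b ≤ 2 * τ).card = B.card := by
      exact_mod_cast h3
    have h6 : τ * (2 * ((B.filter fun b => ¬ dg b ≤ 2 * τ).card : ℝ)) ≤ τ * B.card := by
      have : ∑ b ∈ B, dg b ≤ τ * B.card := h
      linarith
    have h7 := le_of_mul_le_mul_left h6 hτ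
    linarith
  -- maximal independent set
  let ok : Finset β → Prop := fun I => ∀ a ∈ I, ∀ b ∈ I, C a b → a = b
  let F := B1.powerset.filter ok
  have hF : F.Nonempty := ⟨∅, by simp [F, ok]⟩
  obtain ⟨I, hI, hmax⟩ := Finset.exists_max_image F Finset.card hF
  obtain ⟨hIB, hIi⟩ := Finset.mem_filter.1 hI
  rw [Finset.mem_powerset] at hIB
  refine ⟨I, hIB.trans (Finset.filter_subset _ _), hIi, ?_⟩
  have hcov : B1 ⊆ I.biUnion fun i => insert i (B.filter fun b' => C i b') := by
    intro b hb
    rw [Finset.mem_biUnion]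
    by_contra hc
    push Not at hc
    have hbI : b ∉ I := fun hh => hc b hh (Finset.mem_insert_self _ _)
    have hbB : b ∈ B := (Finset.mem_filter.1 hb).1
    have hnc : ∀ i ∈ I, ¬ C i b := by
      intro i hi hC
      exact hc i hi (Finset.mem_insert_of_mem (Finset.mem_filter.2 ⟨hbB, hC⟩))
    have : insert b I ∈ F := by
      refine Finset.mem_filter.2 ⟨Finset.mem_powerset.2 (Finset.insert_subset hb hIB), ?_⟩
      intro x hx y hy hxy
      rcases Finset.mem_insert.1 hx with hx' | hx' <;> rcases Finset.mem_insert.1 hy with hy' | hy'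
      · rw [hx', hy']
      · exact absurd (hsym _ _ (hx' ▸ hxy)) (hnc y hy')
      · exact absurd (hy' ▸ hxy) (hnc x hx')
      · exact hIi x hx' y hy' hxy
    have := hmax _ this
    rw [Finset.card_insert_of_notMem hbI] at this
    omega
  have h8 : (B1.card : ℝ) ≤ I.card * (1 + 2 * τ) := by
    calc (B1.card : ℝ) ≤ ((I.biUnion fun i => insert i (B.filter fun b' => C i b')).card : ℝ) := by
          exact_mod_cast Finset.card_le_card hcov
      _ ≤ ((∑ i ∈ I, (insert i (B.filter fun b' => C i b')).card : ℕ) : ℝ) := by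
          exact_mod_cast Finset.card_biUnion_le
      _ = ∑ i ∈ I, ((insert i (B.filter fun b' => C i b')).card : ℝ) := by push_cast; rfl
      _ ≤ ∑ i ∈ I, (1 + 2 * τ) := by
          apply Finset.sum_le_sum
          intro i hi
          have h9 : dg i ≤ 2 * τ := (Finset.mem_filter.1 (hIB hi)).2
          have h10 : ((insert i (B.filter fun b' => C i b')).card : ℝ) ≤
              (B.filter fun b' => C i b').card + 1 := by exact_mod_cast Finset.card_insert_le _ _
          have : dg i = ((B.filter fun b' => C i b').card : ℝ) := rfl
          linarith
      _ = _ := by rw [Finset.sum_const, nsmul_eq_mul]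
  linarith

end PolyProof
section PolyProof
open scoped Classical
open Finset
set_option linter.unusedSectionVars false

variable {V : Type} [Fintype V]

/-- vertices which have to be avoided -/
noncomputable def Zs (G : SimpleGraph V) (Out : V → Finset V) (b : V) (p : V × V) : Finset V :=
  (insert b (nb G b) ∪ (Out p.1 ∪ Out p.2)) \ {p.1, p.2}

/-- the pair `p` is the trace of `b` on `A` and it survives -/
def good (G : SimpleGraph V) (Out : V → Finset V) (A : Finset V) (b : V) (p : V × V) : Prop :=
  p.1 ∈ A ∧ p.2 ∈ A ∧ ∀ z ∈ Zs G Out b p, z ∉ A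

lemma card_Zs (G : SimpleGraph V) (Out : V → Finset V) (d : ℕ) (hd : 0 < d)
    (hO : ∀ v, (Out v).card ≤ d) (b : V) (hb : (nb G b).card ≤ 4 * d) (p : V × V) :
    (Zs G Out b p).card ≤ 7 * d := by
  unfold Zs
  have h1 := Finset.card_le_card (Finset.sdiff_subset
    (s := insert b (nb G b) ∪ (Out p.1 ∪ Out p.2)) (t := {p.1, p.2}))
  have h2 := Finset.card_union_le (insert b (nb G b)) (Out p.1 ∪ Out p.2)
  have h3 := Finset.card_union_le (Out p.1) (Out p.2)
  have h4 := Finset.card_insert_le b (nb G b)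
  have := hO p.1
  have := hO p.2
  omega

lemma good_trace {G : SimpleGraph V} {Out : V → Finset V} {A : Finset V} {b : V} {p : V × V}
    (h : good G Out A b p) {z : V} (hz : z ∈ A) (hbz : G.Adj b z) : z = p.1 ∨ z = p.2 := by
  by_contra hc
  push Not at hc
  refine h.2.2 z ?_ hz
  simp [Zs, mem_nb, hbz, hc.1, hc.2]

lemma point_lower (G : SimpleGraph V) (Out : V → Finset V) (A : Finset V) (b : V)
    (Q : Finset (V × V))
    (hQ : ∀ p ∈ Q, G.Adj b p.1 ∧ G.Adj b p.2 ∧ p.1 ≠ p.2) :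
    ∑ p ∈ Q, (ind {p.1, p.2} A - ∑ z ∈ Zs G Out b p, ind {p.1, p.2, z} A) ≤
      2 * (if ∃ p ∈ Q, good G Out A b p then (1 : ℝ) else 0) := by
  have hterm : ∀ p ∈ Q, (ind {p.1, p.2} A - ∑ z ∈ Zs G Out b p, ind {p.1, p.2, z} A) ≤
      if good G Out A b p then (1 : ℝ) else 0 := by
    intro p _
    have hn : 0 ≤ ∑ z ∈ Zs G Out b p, ind {p.1, p.2, z} A :=
      Finset.sum_nonneg fun z _ => ind_nonneg _ _
    split_ifs with hg
    · have := ind_le_one {p.1, p.2} A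
      linarith
    · by_cases h12 : p.1 ∈ A ∧ p.2 ∈ A
      · have : ∃ z ∈ Zs G Out b p, z ∈ A := by
          by_contra hc
          push Not at hc
          exact hg ⟨h12.1, h12.2, hc⟩
        obtain ⟨z, hz, hzA⟩ := this
        have h1 : ind {p.1, p.2, z} A = 1 := by
          unfold ind
          rw [if_pos]
          simp [Finset.insert_subset_iff, h12, hzA]
        have h2 := Finset.single_le_sum (f := fun z => ind {p.1, p.2, z} A)
          (fun z _ => ind_nonneg _ _) hz
        simp only [h1] at h2
        have := ind_le_one {p.1, p.2} A
        linarith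
      · have : ind {p.1, p.2} A = 0 := by
          unfold ind
          rw [if_neg]
          simpa [Finset.insert_subset_iff] using h12
        linarith
  refine (Finset.sum_le_sum hterm).trans ?_
  rw [Finset.sum_boole]
  split_ifs with hex
  · obtain ⟨p, hp, hg⟩ := hex
    have : Q.filter (fun p => good G Out A b p) ⊆ {(p.1, p.2), (p.2, p.1)} := by
      intro q hq
      obtain ⟨hq, hqg⟩ := Finset.mem_filter.1 hq
      obtain ⟨a1, a2, a3⟩ := hQ q hq
      have b1 := good_trace hg hqg.1 a1
      have b2 := good_trace hg hqg.2.1 a2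
      simp only [Finset.mem_insert, Finset.mem_singleton, Prod.ext_iff]
      grind
    have h1 := (Finset.card_le_card this).trans Finset.card_le_two
    have : ((Q.filter (fun p => good G Out A b p)).card : ℝ) ≤ 2 := by exact_mod_cast h1
    linarith
  · have : Q.filter (fun p => good G Out A b p) = ∅ := by
      rw [Finset.filter_eq_empty_iff]
      intro p hp hg
      exact hex ⟨p, hp, hg⟩
    simp [this]

/-- pointwise upper bound for a conflict -/
lemma point_upper (G : SimpleGraph V) (Out : V → Finset V) (A : Finset V) (b b' : V)
    (Q Q' : Finset (V × V))
    (hQ : ∀ p ∈ Q, G.Adj b p.1 ∧ G.Adj b p.2 ∧ p.1 ≠ p.2)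
    (hQ' : ∀ p ∈ Q', G.Adj b' p.1 ∧ G.Adj b' p.2 ∧ p.1 ≠ p.2)
    (h : ∃ p ∈ Q, good G Out A b p) (h' : ∃ p ∈ Q', good G Out A b' p) :
    (1 : ℝ) ≤ ∑ z ∈ cn G b b', ∑ a ∈ (nb G b).erase z, ind {z, a} A +
      ∑ q ∈ ((nb G b ×ˢ nb G b) ×ˢ (nb G b' ×ˢ nb G b')).filter
        (fun q => ({q.1.1, q.1.2, q.2.1, q.2.2} : Finset V).card = 4),
          ind {q.1.1, q.1.2, q.2.1, q.2.2} A := by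
  obtain ⟨p, hp, hg⟩ := h
  obtain ⟨q, hq, hg'⟩ := h'
  obtain ⟨p1, p2, p3⟩ := hQ p hp
  obtain ⟨q1, q2, q3⟩ := hQ' q hq
  have n1 : 0 ≤ ∑ z ∈ cn G b b', ∑ a ∈ (nb G b).erase z, ind {z, a} A :=
    Finset.sum_nonneg fun z _ => Finset.sum_nonneg fun a _ => ind_nonneg _ _
  have n2 : 0 ≤ ∑ q ∈ ((nb G b ×ˢ nb G b) ×ˢ (nb G b' ×ˢ nb G b')).filter
        (fun q => ({q.1.1, q.1.2, q.2.1, q.2.2} : Finset V).card = 4),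
          ind {q.1.1, q.1.2, q.2.1, q.2.2} A :=
    Finset.sum_nonneg fun z _ => ind_nonneg _ _
  by_cases hz : ∃ z ∈ A, z ∈ cn G b b'
  · obtain ⟨z, hzA, hzc⟩ := hz
    have : ∃ a ∈ (nb G b).erase z, a ∈ A := by
      by_cases h1 : p.1 = z
      · exact ⟨p.2, by simp [mem_nb, p2, ← h1, p3.symm], hg.2.1⟩
      · exact ⟨p.1, by simp [mem_nb, p1, h1], hg.1⟩
    obtain ⟨a, ha, haA⟩ := this
    have h1 : ind {z, a} A = 1 := by
      unfold ind
      rw [if_pos]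
      simp [Finset.insert_subset_iff, hzA, haA]
    have h2 := Finset.single_le_sum (f := fun a => ind {z, a} A)
          (fun z _ => ind_nonneg _ _) ha
    have h3 := Finset.single_le_sum (f := fun z => ∑ a ∈ (nb G b).erase z, ind {z, a} A)
          (fun z _ => Finset.sum_nonneg fun a _ => ind_nonneg _ _) hzc
    simp only [h1] at h2 h3
    linarith
  · push Not at hz
    have d1 : p.1 ≠ q.1 := fun e => hz p.1 hg.1 (mem_cn.2 ⟨p1, e ▸ q1⟩)
    have d2 : p.1 ≠ q.2 := fun e => hz p.1 hg.1 (mem_cn.2 ⟨p1, e ▸ q2⟩)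
    have d3 : p.2 ≠ q.1 := fun e => hz p.2 hg.2.1 (mem_cn.2 ⟨p2, e ▸ q1⟩)
    have d4 : p.2 ≠ q.2 := fun e => hz p.2 hg.2.1 (mem_cn.2 ⟨p2, e ▸ q2⟩)
    have hm : ((p, q) : (V × V) × (V × V)) ∈
        ((nb G b ×ˢ nb G b) ×ˢ (nb G b' ×ˢ nb G b')).filter
        (fun q => ({q.1.1, q.1.2, q.2.1, q.2.2} : Finset V).card = 4) := by
      rw [Finset.mem_filter]
      refine ⟨by simp [mem_nb, p1, p2, q1, q2], ?_⟩
      rw [Finset.card_insert_of_notMem, Finset.card_insert_of_notMem,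
        Finset.card_insert_of_notMem, Finset.card_singleton]
      · simpa using q3
      · simp [d3, d4]
      · simp [p3, d1, d2]
    have h2 := Finset.single_le_sum
      (f := fun q : (V × V) × (V × V) => ind {q.1.1, q.1.2, q.2.1, q.2.2} A)
          (fun z _ => ind_nonneg _ _) hm
    have h1 : ind {p.1, p.2, q.1, q.2} A = 1 := by
      unfold ind
      rw [if_pos]
      simp [Finset.insert_subset_iff, hg.1, hg.2.1, hg'.1, hg'.2.1]
    simp only [h1] at h2
    linarith

lemma EX_lower (G : SimpleGraph V) (Out : V → Finset V) (d tt : ℕ) (hd : 0 < d) (htt : 14 ≤ tt)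
    (hO : ∀ v, (Out v).card ≤ d) (b : V) (hb : (nb G b).card ≤ 4 * d) (Q : Finset (V × V))
    (hQ : ∀ p ∈ Q, G.Adj b p.1 ∧ G.Adj b p.2 ∧ p.1 ≠ p.2) :
    (Q.card : ℝ) * (1 / ((tt * d : ℕ) : ℝ)) ^ 2 / 4 ≤
      EX (tt * d) (fun A => if ∃ p ∈ Q, good G Out A b p then (1 : ℝ) else 0) := by
  have hm : 0 < tt * d := by positivity
  have h1 := EX_mono (tt * d) (fun A => point_lower G Out A b Q hQ)
  rw [EX_mul, EX_sum] at h1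
  set P : ℝ := 1 / ((tt * d : ℕ) : ℝ) with hP
  have hPd : 14 * (d * P) ≤ 1 := by
    have h2 : (14 : ℝ) ≤ tt := by exact_mod_cast htt
    have h3 : (0 : ℝ) < d := by exact_mod_cast hd
    rw [hP]
    push_cast
    rw [show (d : ℝ) * (1 / (tt * d)) = 1 / tt by field_simp]
    rw [mul_one_div, div_le_one (by linarith)]
    exact h2
  have hP0 : 0 ≤ P := by positivity
  have hterm : ∀ p ∈ Q, P ^ 2 / 2 ≤
      EX (tt * d) (fun A => ind {p.1, p.2} A - ∑ z ∈ Zs G Out b p, ind {p.1, p.2, z} A) := by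
    intro p hp
    rw [EX_sub, EX_sum, EX_ind _ hm, Finset.card_pair (hQ p hp).2.2]
    have h3 : ∀ z ∈ Zs G Out b p, EX (tt * d) (ind {p.1, p.2, z}) = P ^ 3 := by
      intro z hz
      have h4 : z ≠ p.1 ∧ z ≠ p.2 := by
        have := (Finset.mem_sdiff.1 hz).2
        simpa using this
      rw [EX_ind _ hm, Finset.card_insert_of_notMem, Finset.card_insert_of_notMem,
        Finset.card_singleton]
      · simpa using h4.2.symm
      · simp [(hQ p hp).2.2, h4.1.symm]
    have h5 : ∑ z ∈ Zs G Out b p, EX (tt * d) (ind {p.1, p.2, z}) =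
        (Zs G Out b p).card * P ^ 3 := by
      rw [Finset.sum_congr rfl h3, Finset.sum_const, nsmul_eq_mul]
    have h6 : ((Zs G Out b p).card : ℝ) ≤ 7 * d := by
      exact_mod_cast card_Zs G Out d hd hO b hb p
    have h7 : ((Zs G Out b p).card : ℝ) * P ^ 3 ≤ 7 * d * P ^ 3 := by gcongr
    have h8 : 7 * d * P ^ 3 ≤ P ^ 2 / 2 := by
      have : 0 ≤ P ^ 2 * (1 - 14 * (d * P)) := by
        apply mul_nonneg (by positivity); linarith
      nlinarith
    have h9 : ∑ z ∈ Zs G Out b p, EX (tt * d) (fun A => ind {p.1, p.2, z} A) =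
        (Zs G Out b p).card * P ^ 3 := h5
    rw [h9]
    linarith
  have h10 := Finset.sum_le_sum hterm
  rw [Finset.sum_const, nsmul_eq_mul] at h10
  linarith

end PolyProof
section PolyProof
open scoped Classical
open Finset
set_option linter.unusedSectionVars false

variable {V : Type} [Fintype V]

/-- membership in the random set `B` -/
def inB (G : SimpleGraph V) (Out : V → Finset V) (Q : V → Finset (V × V)) (A : Finset V)
    (b : V) : Prop := ∃ p ∈ Q b, good G Out A b p

lemma mem_Zs_out {G : SimpleGraph V} {Out : V → Finset V} {b : V} {p : V × V} {z : V}
    (h : z ∈ Out p.1 ∨ z ∈ Out p.2) (h1 : z ≠ p.1) (h2 : z ≠ p.2) : z ∈ Zs G Out b p := by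
  unfold Zs
  rw [Finset.mem_sdiff, Finset.mem_union, Finset.mem_union]
  refine ⟨Or.inr h, ?_⟩
  simp [h1, h2]

lemma EX_conf_pair (G : SimpleGraph V) (Out : V → Finset V) (d m : ℕ) (hm : 0 < m)
    (Q : V → Finset (V × V)) (b b' : V)
    (hQ : ∀ p ∈ Q b, G.Adj b p.1 ∧ G.Adj b p.2 ∧ p.1 ≠ p.2)
    (hQ' : ∀ p ∈ Q b', G.Adj b' p.1 ∧ G.Adj b' p.2 ∧ p.1 ≠ p.2)
    (hb : (nb G b).card ≤ 4 * d) (hb' : (nb G b').card ≤ 4 * d) :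
    EX m (fun A => if inB G Out Q A b ∧ inB G Out Q A b' then (1 : ℝ) else 0) ≤
      (cn G b b').card * (4 * d * (1 / (m : ℝ)) ^ 2) + (4 * d) ^ 4 * (1 / (m : ℝ)) ^ 4 := by
  have h1 : ∀ A : Finset V, (if inB G Out Q A b ∧ inB G Out Q A b' then (1 : ℝ) else 0) ≤
      ∑ z ∈ cn G b b', ∑ a ∈ (nb G b).erase z, ind {z, a} A +
      ∑ q ∈ ((nb G b ×ˢ nb G b) ×ˢ (nb G b' ×ˢ nb G b')).filter
        (fun q => ({q.1.1, q.1.2, q.2.1, q.2.2} : Finset V).card = 4),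
          ind {q.1.1, q.1.2, q.2.1, q.2.2} A := by
    intro A
    split_ifs with h
    · exact point_upper G Out A b b' (Q b) (Q b') hQ hQ' h.1 h.2
    · exact add_nonneg
        (Finset.sum_nonneg fun z _ => Finset.sum_nonneg fun a _ => ind_nonneg _ _)
        (Finset.sum_nonneg fun z _ => ind_nonneg _ _)
  refine (EX_mono m h1).trans ?_
  rw [EX_add, EX_sum, EX_sum]
  set P : ℝ := 1 / (m : ℝ) with hP
  have hP0 : 0 ≤ P := by positivity
  apply add_le_add
  · rw [← nsmul_eq_mul]
    apply Finset.sum_le_card_nsmul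
    intro z _
    rw [EX_sum]
    have h2 : ∀ a ∈ (nb G b).erase z, EX m (fun A => ind {z, a} A) = P ^ 2 := by
      intro a ha
      have := EX_ind m hm {z, a}
      rw [Finset.card_pair (Finset.ne_of_mem_erase ha).symm] at this
      exact this
    rw [Finset.sum_congr rfl h2, Finset.sum_const, nsmul_eq_mul]
    apply mul_le_mul_of_nonneg_right _ (by positivity)
    exact_mod_cast (Finset.card_erase_le).trans hb
  · set F := ((nb G b ×ˢ nb G b) ×ˢ (nb G b' ×ˢ nb G b')).filter
        (fun q => ({q.1.1, q.1.2, q.2.1, q.2.2} : Finset V).card = 4) with hF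
    have h2 : ∀ q ∈ F, EX m (fun A => ind {q.1.1, q.1.2, q.2.1, q.2.2} A) = P ^ 4 := by
      intro q hq
      have := EX_ind m hm {q.1.1, q.1.2, q.2.1, q.2.2}
      rw [(Finset.mem_filter.1 hq).2] at this
      exact this
    rw [Finset.sum_congr rfl h2, Finset.sum_const, nsmul_eq_mul]
    apply mul_le_mul_of_nonneg_right _ (by positivity)
    have h3 : F.card ≤ (4 * d) ^ 4 := by
      refine (Finset.card_filter_le _ _).trans ?_
      simp only [Finset.card_product]
      calc _ ≤ ((4 * d) * (4 * d)) * ((4 * d) * (4 * d)) := by gcongr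
        _ = _ := by ring
    exact_mod_cast h3

lemma EX_conf (G : SimpleGraph V) (Out : V → Finset V) (d tt : ℕ) (hd : 0 < d) (htt : 0 < tt)
    (Q : V → Finset (V × V)) (Low : Finset V) (b : V) (hbL : b ∈ Low)
    (hQ : ∀ b ∈ Low, ∀ p ∈ Q b, G.Adj b p.1 ∧ G.Adj b p.2 ∧ p.1 ≠ p.2)
    (hb : ∀ b ∈ Low, (nb G b).card ≤ 4 * d) (he : tt ^ 2 * ee G (nb G b) ≤ 16 * d ^ 2) :
    EX (tt * d) (fun A => ∑ b' ∈ Low ∩ nb G b,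
      if inB G Out Q A b ∧ inB G Out Q A b' then (1 : ℝ) else 0) ≤ 1088 * d / (tt : ℝ) ^ 4 := by
  rw [EX_sum]
  have hm : 0 < tt * d := by positivity
  have ht0 : (0 : ℝ) < tt := by exact_mod_cast htt
  have hd0 : (0 : ℝ) < d := by exact_mod_cast hd
  set P : ℝ := 1 / ((tt * d : ℕ) : ℝ) with hP
  have hP0 : 0 ≤ P := by positivity
  calc _ ≤ ∑ b' ∈ Low ∩ nb G b, ((cn G b b').card * (4 * d * P ^ 2) + (4 * d) ^ 4 * P ^ 4) := by
        apply Finset.sum_le_sum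
        intro b' hb'
        have hb'L := (Finset.mem_inter.1 hb').1
        exact EX_conf_pair G Out d (tt * d) hm Q b b' (hQ b hbL) (hQ b' hb'L) (hb b hbL)
          (hb b' hb'L)
    _ ≤ ∑ b' ∈ nb G b, ((cn G b b').card * (4 * d * P ^ 2) + (4 * d) ^ 4 * P ^ 4) := by
        apply Finset.sum_le_sum_of_subset_of_nonneg Finset.inter_subset_right
        intro _ _ _
        positivity
    _ = (ee G (nb G b) : ℝ) * (4 * d * P ^ 2) + (nb G b).card * ((4 * d) ^ 4 * P ^ 4) := by
        rw [Finset.sum_add_distrib, ← Finset.sum_mul, Finset.sum_const, nsmul_eq_mul]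
        congr 2
        simp [ee, cn]
    _ ≤ (16 * d ^ 2 / tt ^ 2) * (4 * d * P ^ 2) + (4 * d) * ((4 * d) ^ 4 * P ^ 4) := by
        apply add_le_add
        · apply mul_le_mul_of_nonneg_right _ (by positivity)
          rw [le_div_iff₀ (by positivity)]
          have : ((tt ^ 2 * ee G (nb G b) : ℕ) : ℝ) ≤ ((16 * d ^ 2 : ℕ) : ℝ) := by
            exact_mod_cast he
          push_cast at this
          linarith
        · apply mul_le_mul_of_nonneg_right _ (by positivity)
          exact_mod_cast hb b hbL
    _ = _ := by
        rw [hP]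
        push_cast
        field_simp
        ring

set_option maxHeartbeats 2000000 in
/-- the sampling lemma -/
lemma sampling (G : SimpleGraph V) (Out : V → Finset V) (d tt R M k : ℕ) (hd : 0 < d)
    (hR : 0 < R) (hk : 0 < k)
    (htt : 10 ^ 10 * R ^ 4 * k ≤ tt) (hdt : M * tt ^ 2 ≤ d) (hdt2 : tt ^ 2 ≤ d)
    (hO : ∀ v, (Out v).card ≤ d) (hO1 : ∀ v, Out v ⊆ nb G v)
    (hO2 : ∀ u v, G.Adj u v → v ∈ Out u ∨ u ∈ Out v)
    (Q : V → Finset (V × V)) (Low : Finset V) (hV : 0 < Fintype.card V)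
    (hLow : Fintype.card V ≤ 2 * Low.card)
    (hQ : ∀ b ∈ Low, ∀ p ∈ Q b, G.Adj b p.1 ∧ G.Adj b p.2 ∧ p.1 ≠ p.2)
    (hQ2 : ∀ b ∈ Low, ∀ p ∈ Q b, ¬ G.Adj p.1 p.2 ∧ (cn G p.1 p.2).card ≤ M)
    (hQ3 : ∀ b ∈ Low, d ^ 2 ≤ 16 * R ^ 2 * (Q b).card)
    (hb : ∀ b ∈ Low, (nb G b).card ≤ 4 * d)
    (he : ∀ b ∈ Low, tt ^ 2 * ee G (nb G b) ≤ 16 * d ^ 2) : OneSub G k := by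
  have hR4 : 0 < R ^ 4 * k := by positivity
  have htt14 : 14 ≤ tt := by nlinarith
  have ht0 : (0 : ℝ) < tt := by exact_mod_cast (by omega : 0 < tt)
  have hd0 : (0 : ℝ) < d := by exact_mod_cast hd
  have hR0 : (0 : ℝ) < R := by exact_mod_cast hR
  have hm : 0 < tt * d := by positivity
  set n := Fintype.card V with hn
  have hn0 : (0 : ℝ) < n := by exact_mod_cast hV
  -- expectations
  let fB : Finset V → ℝ := fun A => ∑ b ∈ Low, if inB G Out Q A b then (1 : ℝ) else 0
  let fC : Finset V → ℝ := fun A => ∑ b ∈ Low, ∑ b' ∈ Low ∩ nb G b,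
      if inB G Out Q A b ∧ inB G Out Q A b' then (1 : ℝ) else 0
  let fA : Finset V → ℝ := fun A => ∑ v : V, ind {v} A
  have EB : (n : ℝ) / (128 * R ^ 2 * tt ^ 2) ≤ EX (tt * d) fB := by
    simp only [fB]
    rw [EX_sum]
    have h1 : ∀ b ∈ Low, (1 : ℝ) / (64 * R ^ 2 * tt ^ 2) ≤
        EX (tt * d) (fun A => if inB G Out Q A b then (1 : ℝ) else 0) := by
      intro b hbL
      refine le_trans ?_ ((EX_lower G Out d tt hd htt14 hO b (hb b hbL) (Q b) (hQ b hbL)).trans_eq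
        (congrArg _ (funext fun A => if_congr Iff.rfl rfl rfl)))
      have h2 : (d : ℝ) ^ 2 ≤ 16 * R ^ 2 * (Q b).card := by exact_mod_cast hQ3 b hbL
      push_cast
      rw [div_pow, one_pow, mul_one_div, div_div, div_le_div_iff₀ (by positivity) (by positivity)]
      have : 0 ≤ (16 * R ^ 2 * (Q b).card - (d : ℝ) ^ 2) * (4 * tt ^ 2) := by
        apply mul_nonneg (by linarith) (by positivity)
      nlinarith
    have h3 := Finset.sum_le_sum h1
    refine le_trans ?_ h3
    rw [Finset.sum_const, nsmul_eq_mul]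
    have h4 : (n : ℝ) ≤ 2 * Low.card := by exact_mod_cast hLow
    rw [mul_one_div, div_le_div_iff₀ (by positivity) (by positivity)]
    have : 0 ≤ (2 * (Low.card : ℝ) - n) * (64 * R ^ 2 * tt ^ 2) := by
      apply mul_nonneg (by linarith) (by positivity)
    nlinarith
  have EC : EX (tt * d) fC ≤ n * (1088 * d / (tt : ℝ) ^ 4) := by
    simp only [fC]
    rw [EX_sum]
    refine (Finset.sum_le_card_nsmul Low _ (1088 * d / (tt : ℝ) ^ 4) ?_).trans ?_
    · intro b hbL
      exact EX_conf G Out d tt hd (by omega) Q Low b hbL hQ hb (he b hbL)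
    · rw [nsmul_eq_mul]
      apply mul_le_mul_of_nonneg_right _ (by positivity)
      exact_mod_cast Finset.card_le_univ Low
  have EA : EX (tt * d) fA = n / (tt * d) := by
    simp only [fA]
    rw [EX_sum]
    have : ∀ v ∈ (univ : Finset V), EX (tt * d) (fun A => ind {v} A) = 1 / ((tt : ℝ) * d) := by
      intro v _
      have := EX_ind (tt * d) hm {v}
      rw [Finset.card_singleton, pow_one] at this
      push_cast at this
      exact this
    rw [Finset.sum_congr rfl this, Finset.sum_const, nsmul_eq_mul, Finset.card_univ, mul_one_div]
  let x : ℝ := tt ^ 2 / (557056 * R ^ 2 * d)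
  let y : ℝ := d / (512 * R ^ 2 * tt)
  have hx0 : 0 < x := by positivity
  have hy0 : 0 < y := by positivity
  have hpos : 0 < EX (tt * d) (fun A => fB A - (x * fC A + y * fA A)) := by
    rw [EX_sub, EX_add, EX_mul, EX_mul, EA]
    have h1 : x * EX (tt * d) fC ≤ x * (n * (1088 * d / (tt : ℝ) ^ 4)) := by gcongr
    have h2 : x * (n * (1088 * d / (tt : ℝ) ^ 4)) = n / (512 * R ^ 2 * tt ^ 2) := by
      simp only [x]; field_simp; norm_num
    have h3 : y * (n / (tt * d)) = n / (512 * R ^ 2 * tt ^ 2) := by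
      simp only [y]; field_simp
    have h4 : (n : ℝ) / (128 * R ^ 2 * tt ^ 2) = 4 * (n / (512 * R ^ 2 * tt ^ 2)) := by
      field_simp; norm_num
    have h5 : 0 < (n : ℝ) / (512 * R ^ 2 * tt ^ 2) := by positivity
    linarith
  obtain ⟨A0, hA0⟩ := EX_pos _ hpos
  let B := Low.filter (fun b => inB G Out Q A0 b)
  let A := A0.filter (fun a => ∀ z ∈ Out a, z ∉ A0)
  have hfB : fB A0 = B.card := by simp only [fB, B]; rw [Finset.sum_boole]
  have hfA : fA A0 = A0.card := by
    simp only [fA, ind, Finset.singleton_subset_iff]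
    rw [Finset.sum_boole]
    simp
  have hfC : fC A0 = ∑ b ∈ B, ((B.filter fun b' => G.Adj b b').card : ℝ) := by
    simp only [fC, B]
    rw [Finset.sum_filter]
    apply Finset.sum_congr rfl
    intro b _
    split_ifs with h
    · rw [Finset.sum_boole]
      congr 2
      ext b'
      simp only [mem_filter, mem_inter, mem_nb]
      tauto
    · apply Finset.sum_eq_zero
      intro b' _
      rw [if_neg]
      tauto
  have hfA0 : 0 ≤ y * fA A0 := by
    rw [hfA]
    exact mul_nonneg hy0.le (Nat.cast_nonneg _)
  have hfC0 : 0 ≤ x * fC A0 := by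
    rw [hfC]
    exact mul_nonneg hx0.le (Finset.sum_nonneg fun _ _ => Nat.cast_nonneg _)
  -- traces
  have htr : ∀ b ∈ B, ∃ p ∈ Q b, p.1 ∈ A ∧ p.2 ∈ A ∧ ∀ z ∈ A, G.Adj b z ↔ (z = p.1 ∨ z = p.2) := by
    intro b hbB
    obtain ⟨hbL, p, hp, hg⟩ := Finset.mem_filter.1 hbB
    obtain ⟨p1, p2, p3⟩ := hQ b hbL p hp
    obtain ⟨q1, q2⟩ := hQ2 b hbL p hp
    refine ⟨p, hp, ?_, ?_, ?_⟩
    · refine Finset.mem_filter.2 ⟨hg.1, ?_⟩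
      intro z hz hzA
      have hz1 := mem_nb.1 (hO1 _ hz)
      have hz2 : z ≠ p.2 := fun e => q1 (e ▸ hz1)
      exact hg.2.2 z (mem_Zs_out (Or.inl hz) hz1.ne' hz2) hzA
    · refine Finset.mem_filter.2 ⟨hg.2.1, ?_⟩
      intro z hz hzA
      have hz1 := mem_nb.1 (hO1 _ hz)
      have hz2 : z ≠ p.1 := fun e => q1 (e ▸ hz1).symm
      exact hg.2.2 z (mem_Zs_out (Or.inr hz) hz2 hz1.ne') hzA
    · intro z hz
      constructor
      · intro h
        exact good_trace hg (Finset.mem_filter.1 hz).1 h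
      · rintro (rfl | rfl)
        · exact p1
        · exact p2
  let C : V → V → Prop := fun b b' => G.Adj b b' ∨ (∀ z ∈ A, G.Adj b z ↔ G.Adj b' z)
  have hsum : ∑ b ∈ B, ((B.filter fun b' => C b b').card : ℝ) ≤ (1 / x + M) * B.card := by
    have h1 : ∀ b ∈ B, ((B.filter fun b' => C b b').card : ℝ) ≤
        ((B.filter fun b' => G.Adj b b').card : ℝ) + M := by
      intro b hbB
      obtain ⟨p, hp, hpA, hpA', hpt⟩ := htr b hbB
      have hbL := (Finset.mem_filter.1 hbB).1
      obtain ⟨q1, q2⟩ := hQ2 b hbL p hp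
      have h2 : (B.filter fun b' => C b b') ⊆ (B.filter fun b' => G.Adj b b') ∪
          cn G p.1 p.2 := by
        intro b' hb'
        obtain ⟨hb'B, hC⟩ := Finset.mem_filter.1 hb'
        rw [Finset.mem_union]
        rcases hC with hC | hC
        · left
          exact Finset.mem_filter.2 ⟨hb'B, hC⟩
        · right
          rw [mem_cn]
          exact ⟨((hC _ hpA).1 ((hpt _ hpA).2 (Or.inl rfl))).symm,
            ((hC _ hpA').1 ((hpt _ hpA').2 (Or.inr rfl))).symm⟩
      have h3 := (Finset.card_le_card h2).trans (Finset.card_union_le _ _)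
      exact_mod_cast h3.trans (Nat.add_le_add_left q2 _)
    refine (Finset.sum_le_sum h1).trans ?_
    rw [Finset.sum_add_distrib, Finset.sum_const, nsmul_eq_mul, ← hfC]
    have h2 : x * fC A0 ≤ B.card := by linarith
    have h3 : fC A0 ≤ 1 / x * B.card := by
      rw [one_div, inv_mul_eq_div, le_div_iff₀ hx0]; linarith
    linarith
  have hτ : 0 < 1 / x + (M : ℝ) :=
    add_pos_of_pos_of_nonneg (one_div_pos.2 hx0) (Nat.cast_nonneg _)
  obtain ⟨I, hIB, hIi, hIc⟩ := weak_turan B C (by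
    intro a b h
    rcases h with h | h
    · exact Or.inl h.symm
    · exact Or.inr fun z hz => (h z hz).symm) _ hτ (by convert hsum)
  have hBne : B.Nonempty := by
    rw [← Finset.card_pos]
    have : (0 : ℝ) < B.card := by linarith
    exact_mod_cast this
  refine ⟨A, I, ?_, ?_, ?_, ?_, ?_, ?_⟩
  · obtain ⟨b, hbB⟩ := hBne
    obtain ⟨p, _, hpA, _⟩ := htr b hbB
    exact ⟨_, hpA⟩
  · intro a ha a' ha' hadj
    rcases hO2 a a' hadj with h | h
    · exact (Finset.mem_filter.1 ha).2 _ h (Finset.mem_filter.1 ha').1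
    · exact (Finset.mem_filter.1 ha').2 _ h (Finset.mem_filter.1 ha).1
  · intro b hbI b' hb'I hadj
    have := hIi b hbI b' hb'I (Or.inl hadj)
    exact hadj.ne this
  · intro b hbI
    obtain ⟨p, hp, hpA, hpA', hpt⟩ := htr b (hIB hbI)
    exact ⟨_, hpA, _, hpA', (hQ b (Finset.mem_filter.1 (hIB hbI)).1 p hp).2.2, hpt⟩
  · intro b hbI b' hb'I h
    exact hIi b hbI b' hb'I (Or.inr h)
  · have hAc : A.card ≤ A0.card := Finset.card_filter_le _ _
    suffices h : (k : ℝ) * A0.card ≤ I.card by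
      have : k * A0.card ≤ I.card := by exact_mod_cast h
      exact (Nat.mul_le_mul_left _ hAc).trans this
    have h1 : y * A0.card ≤ B.card := by rw [← hfA]; linarith
    have h2 : 1 + 2 * (1 / x + (M : ℝ)) ≤ 2000000 * R ^ 2 * d / tt ^ 2 := by
      rw [le_div_iff₀ (by positivity)]
      have e1 : 1 / x * tt ^ 2 = 557056 * R ^ 2 * d := by
        simp only [x]; field_simp
      have e2 : (M : ℝ) * tt ^ 2 ≤ d := by exact_mod_cast hdt
      have e3 : (tt : ℝ) ^ 2 ≤ d := by exact_mod_cast hdt2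
      have e4 : (1 : ℝ) ≤ R := by exact_mod_cast hR
      have e5 : (d : ℝ) ≤ R ^ 2 * d := le_mul_of_one_le_left hd0.le (one_le_pow₀ e4)
      nlinarith
    have h3 : y * A0.card ≤ 2 * (2000000 * R ^ 2 * d / tt ^ 2) * I.card := by
      refine h1.trans (hIc.trans ?_)
      gcongr
    have h4 : (tt : ℝ) * A0.card ≤ 2048000000 * R ^ 4 * I.card := by
      have h5 : (512 * R ^ 2 * tt ^ 2 / d : ℝ) * (y * A0.card) ≤
          (512 * R ^ 2 * tt ^ 2 / d : ℝ) * (2 * (2000000 * R ^ 2 * d / tt ^ 2) * I.card) := by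
        gcongr
      have h6 : (512 * R ^ 2 * tt ^ 2 / d : ℝ) * (y * A0.card) = tt * A0.card := by
        simp only [y]; field_simp
      have h7 : (512 * R ^ 2 * tt ^ 2 / d : ℝ) * (2 * (2000000 * R ^ 2 * d / tt ^ 2) * I.card) =
          2048000000 * R ^ 4 * I.card := by
        field_simp; ring
      linarith
    have h8 : (10 : ℝ) ^ 10 * R ^ 4 * k ≤ tt := by exact_mod_cast htt
    have h9 : (10 : ℝ) ^ 10 * R ^ 4 * k * A0.card ≤ tt * A0.card := by gcongr
    have h10 : (R : ℝ) ^ 4 * (10 ^ 10 * (k * A0.card)) ≤ R ^ 4 * (2048000000 * I.card) := by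
      linarith
    have h11 := le_of_mul_le_mul_left h10 (by positivity)
    have h12 : (0 : ℝ) ≤ I.card := by positivity
    linarith

end PolyProof
section PolyProof
open scoped Classical
open Finset
set_option linter.unusedSectionVars false

variable {V : Type} [Fintype V]

/-- sampling parameter -/
def TT (s k : ℕ) : ℕ := 10 ^ 10 * RR s k ^ 4 * k

/-- the degree bound -/
def DD (s k : ℕ) : ℕ :=
  TT s k ^ 4 * (8 * RR s k ^ 2 * MM s k + 16 * GG s k ^ 2 + 1) + (4 * GG s k + 1)
    + MM s k * TT s k ^ 2

lemma card_Q (G : SimpleGraph V) (M : ℕ) (X : Finset V) :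
    (lightP G M X).card ≤
      ((lightP G M X).filter fun p => ¬ G.Adj p.1 p.2).card + ee G X := by
  have h1 := Finset.card_filter_add_card_filter_not (s := lightP G M X)
    (fun p : V × V => G.Adj p.1 p.2)
  have h2 : ((lightP G M X).filter fun p => G.Adj p.1 p.2).card ≤ ee G X := by
    have h3 : ((lightP G M X).filter fun p => G.Adj p.1 p.2) ⊆
        (X ×ˢ X).filter fun p => G.Adj p.1 p.2 := by
      intro p hp
      obtain ⟨hp1, hp2⟩ := Finset.mem_filter.1 hp
      refine Finset.mem_filter.2 ⟨?_, hp2⟩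
      exact Finset.mem_product.2 (mem_lightP.1 hp1).1
    refine (Finset.card_le_card h3).trans ?_
    rw [Finset.card_filter, Finset.sum_product]
    unfold ee
    apply Finset.sum_le_sum
    intro v _
    rw [← Finset.card_filter]
    apply Finset.card_le_card
    intro u hu
    obtain ⟨hu1, hu2⟩ := Finset.mem_filter.1 hu
    exact Finset.mem_inter.2 ⟨hu1, mem_nb.2 hu2⟩
  omega

lemma core {s k : ℕ} (hs : 0 < s) (hk : 0 < k) {G : SimpleGraph V} (hK : KFree s G)
    (hV : 0 < Fintype.card V) (d : ℕ) (hD : DD s k ≤ d) (hmin : ∀ v, d ≤ (nb G v).card)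
    (hdeg : ∀ T : Finset V, T.Nonempty → ∃ v ∈ T, (T ∩ nb G v).card ≤ d) : OneSub G k := by
  by_contra hcon
  obtain ⟨Out, hO1, hO2⟩ := exists_orient G d hdeg univ
  have hR : 0 < RR s k := Nat.pow_pos (by omega)
  have hT : 0 < TT s k := by unfold TT; positivity
  have hTR : 16 * RR s k ^ 2 ≤ TT s k ^ 2 := by
    have h1 : 4 * RR s k ≤ TT s k := by
      unfold TT
      have : RR s k ≤ RR s k ^ 4 * k := by
        calc RR s k = RR s k ^ 1 * 1 := by ring
          _ ≤ RR s k ^ 4 * k := Nat.mul_le_mul (Nat.pow_le_pow_right hR (by norm_num)) hk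
      have h3 : 10 ^ 10 * RR s k ^ 4 * k = 10 ^ 10 * (RR s k ^ 4 * k) := by ring
      rw [h3]
      omega
    calc 16 * RR s k ^ 2 = (4 * RR s k) ^ 2 := by ring
      _ ≤ _ := Nat.pow_le_pow_left h1 2
  have hd4 : 4 * GG s k < d := by unfold DD at hD; omega
  have hdM : MM s k * TT s k ^ 2 ≤ d := by unfold DD at hD; omega
  have hdE : TT s k ^ 4 * (8 * RR s k ^ 2 * MM s k + 16 * GG s k ^ 2 + 1) ≤ d := by
    unfold DD at hD; omega
  have hdT : TT s k ^ 2 ≤ d := by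
    refine le_trans ?_ hdE
    calc TT s k ^ 2 = TT s k ^ 2 * 1 := by ring
      _ ≤ TT s k ^ 4 * (8 * RR s k ^ 2 * MM s k + 16 * GG s k ^ 2 + 1) :=
        Nat.mul_le_mul (Nat.pow_le_pow_right hT (by norm_num)) (by omega)
  have hd : 0 < d := by omega
  have hT2 : 0 < TT s k ^ 2 := by positivity
  set M := d / TT s k ^ 2 with hM
  have hMM : MM s k ≤ M := (Nat.le_div_iff_mul_le hT2).2 hdM
  have hMd : M ≤ d := Nat.div_le_self _ _
  let Low := univ.filter fun v => (nb G v).card ≤ 4 * d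
  have hbL : ∀ b ∈ Low, (nb G b).card ≤ 4 * d := fun b hb => (Finset.mem_filter.1 hb).2
  let Q : V → Finset (V × V) := fun b => (lightP G M (nb G b)).filter fun p => ¬ G.Adj p.1 p.2
  have hE : ∀ b, TT s k ^ 2 * ee G (nb G b) ≤ (nb G b).card ^ 2 := by
    intro b
    by_contra hc
    push Not at hc
    apply hcon
    refine dense_edges hs hK (nb G b) (TT s k ^ 2) hc.le hT2 ?_
    refine le_trans ?_ (hmin b)
    rw [← pow_mul]
    exact hdE
  have hLt : ∀ b, (nb G b).card ^ 2 < 8 * RR s k ^ 2 * (lightP G M (nb G b)).card := by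
    intro b
    by_contra hc
    push Not at hc
    exact hcon (dense_total hs hK (nb G b) M hMM hc (lt_of_lt_of_le hd4 (hmin b)))
  refine hcon (sampling G Out d (TT s k) (RR s k) M k hd hR hk le_rfl ?_ hdT
    (fun v => (hO1 v (mem_univ _)).2) (fun v => (hO1 v (mem_univ _)).1)
    (fun u v => hO2 u (mem_univ _) v (mem_univ _)) Q Low hV
    (card_low G d hd Out (fun v => (hO1 v (mem_univ _)).2)
      (fun u v => hO2 u (mem_univ _) v (mem_univ _))) ?_ ?_ ?_ hbL ?_)
  · exact Nat.div_mul_le_self _ _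
  · intro b _ p hp
    obtain ⟨hp1, hp2⟩ := Finset.mem_filter.1 hp
    obtain ⟨⟨h1, h2⟩, h3⟩ := mem_lightP.1 hp1
    refine ⟨mem_nb.1 h1, mem_nb.1 h2, ?_⟩
    intro he
    rw [he] at h3
    have h4 : (cn G p.2 p.2).card = (nb G p.2).card := by
      congr 1
      ext y
      simp [mem_cn, mem_nb]
    have := hmin p.2
    omega
  · intro b _ p hp
    obtain ⟨hp1, hp2⟩ := Finset.mem_filter.1 hp
    obtain ⟨_, h3⟩ := mem_lightP.1 hp1
    exact ⟨hp2, h3.le⟩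
  · intro b _
    have h1 := hE b
    have h2 := hLt b
    have h3 := card_Q G M (nb G b)
    have h4 : 16 * RR s k ^ 2 * ee G (nb G b) ≤ (nb G b).card ^ 2 :=
      (Nat.mul_le_mul_right _ hTR).trans h1
    have h5 : d ^ 2 ≤ (nb G b).card ^ 2 := Nat.pow_le_pow_left (hmin b) 2
    have h6 : 16 * RR s k ^ 2 * (lightP G M (nb G b)).card ≤
        16 * RR s k ^ 2 * ((Q b).card + ee G (nb G b)) := Nat.mul_le_mul_left _ h3
    rw [Nat.mul_add] at h6
    have h7 : 16 * RR s k ^ 2 * (lightP G M (nb G b)).card =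
      2 * (8 * RR s k ^ 2 * (lightP G M (nb G b)).card) := by ring
    omega
  · intro b hb
    refine (hE b).trans ?_
    calc (nb G b).card ^ 2 ≤ (4 * d) ^ 2 := Nat.pow_le_pow_left (hbL b hb) 2
      _ = _ := by ring

end PolyProof
section PolyProof
open scoped Classical
open Finset
set_option linter.unusedSectionVars false

lemma edgeSubdiv_some {W : Type} {S : SimpleGraph W} {a b x y : W} :
    (edgeSubdiv S a b).Adj (some x) (some y) ↔
      S.Adj x y ∧ ¬ ((x = a ∧ y = b) ∨ (x = b ∧ y = a)) := by
  simp only [edgeSubdiv, SimpleGraph.fromRel_adj]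
  constructor
  · rintro ⟨_, (⟨x', y', h1, h2, h3, h4⟩ | ⟨h, _⟩) | (⟨x', y', h1, h2, h3, h4⟩ | ⟨h, _⟩)⟩
    · cases h1; cases h2; exact ⟨h3, h4⟩
    · cases h
    · cases h1; cases h2; exact ⟨h3.symm, by tauto⟩
    · cases h
  · rintro ⟨h1, h2⟩
    exact ⟨by simpa using h1.ne, Or.inl (Or.inl ⟨x, y, rfl, rfl, h1, h2⟩)⟩

lemma edgeSubdiv_none {W : Type} {S : SimpleGraph W} {a b x : W} :
    (edgeSubdiv S a b).Adj none (some x) ↔ (x = a ∨ x = b) := by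
  simp [edgeSubdiv, SimpleGraph.fromRel_adj]

lemma edgeSubdiv_none' {W : Type} {S : SimpleGraph W} {a b x : W} :
    (edgeSubdiv S a b).Adj (some x) none ↔ (x = a ∨ x = b) := by
  rw [SimpleGraph.adj_comm, edgeSubdiv_none]

lemma edgeSubdiv_sup {W : Type} {S : SimpleGraph W} {a b c v : W} (hab : S.Adj a b)
    (hcv : ¬ S.Adj c v) (hne : c ≠ v) :
    edgeSubdiv (S ⊔ SimpleGraph.edge c v) a b =
      edgeSubdiv S a b ⊔ SimpleGraph.edge (some c) (some v) := by
  ext x y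
  rcases x with _ | x <;> rcases y with _ | y
  · simp
  · simp [edgeSubdiv_none, SimpleGraph.edge_adj]
  · simp [edgeSubdiv_none', SimpleGraph.edge_adj]
  · simp only [SimpleGraph.sup_adj, edgeSubdiv_some, SimpleGraph.edge_adj]
    have hcv' : ¬ S.Adj v c := fun h => hcv h.symm
    constructor
    · rintro ⟨h1 | h1, h2⟩
      · exact Or.inl ⟨h1, h2⟩
      · right
        simpa using h1
    · rintro (⟨h1, h2⟩ | h1)
      · exact ⟨Or.inl h1, h2⟩
      · have h3 : (x = c ∧ y = v ∨ x = v ∧ y = c) ∧ x ≠ y := by simpa using h1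
        refine ⟨Or.inr h3, ?_⟩
        rintro (⟨rfl, rfl⟩ | ⟨rfl, rfl⟩)
        · rcases h3 with ⟨⟨rfl, rfl⟩ | ⟨rfl, rfl⟩, _⟩
          · exact hcv hab
          · exact hcv' hab
        · rcases h3 with ⟨⟨rfl, rfl⟩ | ⟨rfl, rfl⟩, _⟩
          · exact hcv' hab
          · exact hcv hab

lemma lift_sub {VH W : Type} {H : SimpleGraph VH} {S : SimpleGraph W} (h : IsSubdivision H S) :
    ∃ ι : VH → W, Function.Injective ι ∧ ∀ x y, x ≠ y → ¬ H.Adj x y →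
      ¬ S.Adj (ι x) (ι y) ∧
      IsSubdivision (H ⊔ SimpleGraph.edge x y) (S ⊔ SimpleGraph.edge (ι x) (ι y)) := by
  induction h with
  | refl G => exact ⟨id, Function.injective_id, fun x y _ h => ⟨h, IsSubdivision.refl _⟩⟩
  | step G S a b _ hab ih =>
    obtain ⟨ι, hι, h⟩ := ih
    refine ⟨fun x => some (ι x), fun x y hxy => hι (Option.some_injective _ hxy), ?_⟩
    intro x y hxy hG
    obtain ⟨h1, h2⟩ := h x y hxy hG
    refine ⟨fun hh => h1 (edgeSubdiv_some.1 hh).1, ?_⟩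
    have := IsSubdivision.step _ _ a b h2 (Or.inl hab)
    rwa [edgeSubdiv_sup hab h1 (fun e => hxy (hι e))] at this

/-- a (not necessarily induced) copy of a subdivision of `H` in `G` inside `X` -/
def SubIn {VH V : Type} (H : SimpleGraph VH) (G : SimpleGraph V) (X : Set V) : Prop :=
  ∃ (W : Type) (S : SimpleGraph W) (f : W → V), IsSubdivision H S ∧ Function.Injective f ∧
    (∀ x y, S.Adj x y → G.Adj (f x) (f y)) ∧ ∀ x, f x ∈ X

lemma path_ext {VH V : Type} {H : SimpleGraph VH} {G : SimpleGraph V} (X : Set V) {u w : V}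
    (p : G.Walk u w) : p.IsPath → (∀ z ∈ p.support, z ∈ X) →
    ∀ (W : Type) (S : SimpleGraph W) (c v : W) (f : W → V), Function.Injective f → S.Adj c v →
      f c = u → f v = w →
      (∀ x y, S.Adj x y → ¬ (x = c ∧ y = v ∨ x = v ∧ y = c) → G.Adj (f x) (f y)) →
      (∀ x, f x ∈ X) → (∀ z ∈ p.support, z ∈ Set.range f → z = u ∨ z = w) →
      IsSubdivision H S → SubIn H G X := by
  induction p with
  | nil =>
    intro _ _ W S c v f hf hcv hc hv
    exact absurd (hf (hc.trans hv.symm)) hcv.ne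
  | @cons u u' w hadj q ih =>
    intro hp hX W S c v f hf hcv hc hv hhom hfX hint hS
    rw [SimpleGraph.Walk.cons_isPath_iff] at hp
    by_cases huw : u' = w
    · refine ⟨W, S, f, hS, hf, ?_, hfX⟩
      intro x y hxy
      by_cases h : x = c ∧ y = v ∨ x = v ∧ y = c
      · rcases h with ⟨rfl, rfl⟩ | ⟨rfl, rfl⟩
        · rw [hc, hv, ← huw]; exact hadj
        · rw [hc, hv, ← huw]; exact hadj.symm
      · exact hhom x y hxy h
    · have hu' : u' ∉ Set.range f := by
        intro h
        rcases hint u' (by simp) h with h | h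
        · exact hadj.ne h.symm
        · exact huw h
      refine ih hp.1 (fun z hz => hX z (by simp [hz])) (Option W) (edgeSubdiv S c v) none (some v)
        (fun o => o.elim u' f) ?_ (edgeSubdiv_none.2 (Or.inr rfl)) rfl hv ?_ ?_ ?_
        (IsSubdivision.step _ _ _ _ hS hcv)
      · rintro (_ | x) (_ | y) h
        · rfl
        · exact absurd ⟨y, h.symm⟩ hu'
        · exact absurd ⟨x, h⟩ hu'
        · exact congrArg _ (hf h)
      · rintro (_ | x) (_ | y) h h2
        · exact absurd h (SimpleGraph.irrefl _)
        · rcases edgeSubdiv_none.1 h with rfl | rfl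
          · show G.Adj u' (f y)
            rw [hc]; exact hadj.symm
          · exact absurd (Or.inl ⟨rfl, rfl⟩) h2
        · rcases edgeSubdiv_none'.1 h with rfl | rfl
          · show G.Adj (f x) u'
            rw [hc]; exact hadj
          · exact absurd (Or.inr ⟨rfl, rfl⟩) h2
        · have := edgeSubdiv_some.1 h
          exact hhom x y this.1 this.2
      · rintro (_ | x)
        · exact hX u' (by simp)
        · exact hfX x
      · rintro z hz ⟨o, ho⟩
        rcases o with _ | x
        · exact Or.inl ho.symm
        · rcases hint z (by simp [hz]) ⟨x, ho⟩ with h | h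
          · exact absurd (h ▸ hz) hp.2
          · exact Or.inr h

end PolyProof
section PolyProof
open scoped Classical
open Finset
set_option linter.unusedSectionVars false

variable {V : Type} [Fintype V]

lemma ee_erase (G : SimpleGraph V) (T : Finset V) (w : V) (hw : w ∈ T) :
    ee G T = ee G (T.erase w) + 2 * (T ∩ nb G w).card := by
  unfold ee
  rw [← Finset.add_sum_erase T _ hw]
  have h1 : ∀ v ∈ T.erase w, (T ∩ nb G v).card =
      (T.erase w ∩ nb G v).card + if G.Adj w v then 1 else 0 := by
    intro v hv
    have h2 : T.erase w ∩ nb G v = (T ∩ nb G v).erase w := by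
      ext z; simp only [mem_inter, mem_erase]; tauto
    rw [h2]
    split_ifs with h
    · rw [Finset.card_erase_add_one]
      simp [hw, mem_nb, h.symm]
    · rw [Finset.erase_eq_of_notMem]
      · rfl
      · simp only [mem_inter, mem_nb]
        exact fun hh => h hh.2.symm
  rw [Finset.sum_congr rfl h1, Finset.sum_add_distrib, ← Finset.card_filter]
  have h3 : (T.erase w).filter (fun v => G.Adj w v) = T ∩ nb G w := by
    ext z
    simp only [mem_filter, mem_erase, mem_inter, mem_nb]
    constructor
    · rintro ⟨⟨_, h⟩, h'⟩; exact ⟨h, h'⟩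
    · rintro ⟨h, h'⟩; exact ⟨⟨h'.ne', h⟩, h'⟩
  rw [h3]
  ring

/-- neighbours of `U` in `S` -/
noncomputable def NN (G : SimpleGraph V) (S U : Finset V) : Finset V :=
  (S \ U).filter fun w => ∃ u ∈ U, G.Adj u w

/-- connected vertex set -/
def Conn (G : SimpleGraph V) (U : Finset V) : Prop :=
  ∀ u ∈ U, ∀ v ∈ U, ∃ p : G.Walk u v, ∀ z ∈ p.support, z ∈ U

lemma conn_insert (G : SimpleGraph V) (U : Finset V) (h : Conn G U) (u w : V) (hu : u ∈ U)
    (huw : G.Adj u w) : Conn G (insert w U) := by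
  have key : ∀ a ∈ insert w U, ∃ p : G.Walk a u, ∀ z ∈ p.support, z ∈ insert w U := by
    intro a ha
    rcases Finset.mem_insert.1 ha with rfl | ha
    · refine ⟨SimpleGraph.Walk.cons huw.symm SimpleGraph.Walk.nil, ?_⟩
      intro z hz
      simp at hz
      rcases hz with rfl | rfl
      · simp
      · simp [hu]
    · obtain ⟨p, hp⟩ := h a ha u hu
      exact ⟨p, fun z hz => Finset.mem_insert_of_mem (hp z hz)⟩
  intro a ha b hb
  obtain ⟨p, hp⟩ := key a ha
  obtain ⟨q, hq⟩ := key b hb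
  refine ⟨p.append q.reverse, ?_⟩
  intro z hz
  rw [SimpleGraph.Walk.mem_support_append_iff] at hz
  rcases hz with hz | hz
  · exact hp z hz
  · exact hq z (by simpa using hz)

lemma mem_NN {G : SimpleGraph V} {S U : Finset V} {z : V} :
    z ∈ NN G S U ↔ (z ∈ S ∧ z ∉ U) ∧ ∃ u ∈ U, G.Adj u z := by
  simp only [NN, mem_filter, mem_sdiff]

lemma NN_insert (G : SimpleGraph V) (S U : Finset V) (w : V) :
    NN G S (insert w U) = (NN G S U).erase w ∪ ((S \ U ∩ nb G w) \ NN G S U) := by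
  ext z
  simp only [mem_union, mem_erase, mem_sdiff, mem_inter, mem_NN, mem_nb, mem_insert,
    exists_eq_or_imp]
  generalize (∃ u ∈ U, G.Adj u z) = E
  constructor
  · rintro ⟨⟨h1, h2⟩, h3⟩
    by_cases hE : E
    · exact Or.inl ⟨fun h => h2 (Or.inl h), ⟨h1, fun h => h2 (Or.inr h)⟩, hE⟩
    · exact Or.inr ⟨⟨⟨h1, fun h => h2 (Or.inr h)⟩, h3.resolve_right hE⟩, fun h => hE h.2⟩
  · rintro (⟨h1, ⟨h2, h3⟩, h4⟩ | ⟨⟨⟨h1, h2⟩, h3⟩, h4⟩)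
    · exact ⟨⟨h2, fun h => h.elim h1 h3⟩, Or.inr h4⟩
    · exact ⟨⟨h1, fun h => h.elim h3.ne' h2⟩, Or.inl h3⟩

lemma mader_struct (G : SimpleGraph V) (k' : ℕ) (S0 : Finset V) (hS0 : S0.Nonempty)
    (hE0 : (2 * k' + 2) * S0.card ≤ ee G S0) :
    ∃ U Y : Finset V, U ⊆ S0 ∧ Y ⊆ S0 ∧ Disjoint U Y ∧ Conn G U ∧ Y.Nonempty ∧
      (∀ w ∈ Y, ∃ u ∈ U, G.Adj u w) ∧ k' * Y.card ≤ ee G Y := by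
  set k := 2 * k' + 2 with hk
  let ok : Finset V → Prop := fun S => S ⊆ S0 ∧ S.Nonempty ∧ k * S.card ≤ ee G S
  obtain ⟨S, hS, hSmin⟩ := Finset.exists_min_image (univ.filter ok) Finset.card
    ⟨S0, by simp [ok, hS0, hE0]⟩
  obtain ⟨-, hSS0, hSne, hSE⟩ := Finset.mem_filter.1 hS
  have hmin : ∀ T : Finset V, T ⊆ S0 → T.Nonempty → k * T.card ≤ ee G T → S.card ≤ T.card :=
    fun T h1 h2 h3 => hSmin T (Finset.mem_filter.2 ⟨mem_univ _, h1, h2, h3⟩)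
  let P : Finset V → Prop := fun U => U ⊆ S ∧ U.Nonempty ∧ Conn G U ∧
    k * ((S \ U).card + 1) ≤ ee G (S \ U) + 2 * (NN G S U).card
  have hPne : (univ.filter P).Nonempty := by
    obtain ⟨v, hv⟩ := hSne
    refine ⟨{v}, Finset.mem_filter.2 ⟨mem_univ _, by simpa using hv, by simp, ?_, ?_⟩⟩
    · intro a ha b hb
      rw [Finset.mem_singleton] at ha hb
      subst ha; subst hb
      exact ⟨SimpleGraph.Walk.nil, by simp⟩
    · have h1 := ee_erase G S v hv
      have h2 : S \ {v} = S.erase v := Finset.sdiff_singleton_eq_erase v S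
      have h3 : NN G S {v} = S ∩ nb G v := by
        ext z
        simp only [NN, mem_filter, mem_sdiff, mem_singleton, exists_eq_left, mem_inter, mem_nb]
        constructor
        · rintro ⟨⟨h, _⟩, h'⟩; exact ⟨h, h'⟩
        · rintro ⟨h, h'⟩; exact ⟨⟨h, h'.ne'⟩, h'⟩
      rw [h2, h3, Finset.card_erase_add_one hv]
      omega
  obtain ⟨U, hU, hUmax⟩ := Finset.exists_max_image _ Finset.card hPne
  obtain ⟨-, hUS, hUne, hUc, hUP⟩ := Finset.mem_filter.1 hU
  have hUpos : 0 < U.card := hUne.card_pos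
  have hcard : (S \ U).card + U.card = S.card := Finset.card_sdiff_add_card_eq_card hUS
  refine ⟨U, NN G S U, hUS.trans hSS0, ?_, ?_, hUc, ?_, ?_, ?_⟩
  · intro w hw
    exact hSS0 (Finset.mem_sdiff.1 (Finset.mem_filter.1 hw).1).1
  · rw [Finset.disjoint_left]
    intro w hw hw2
    exact (Finset.mem_sdiff.1 (Finset.mem_filter.1 hw2).1).2 hw
  · by_contra hne
    rw [Finset.not_nonempty_iff_eq_empty] at hne
    rw [hne] at hUP
    simp only [Finset.card_empty, mul_zero, add_zero] at hUP
    rcases (S \ U).eq_empty_or_nonempty with h | h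
    · rw [h] at hUP
      simp [ee] at hUP
    · have := hmin (S \ U) (Finset.sdiff_subset.trans hSS0) h (by nlinarith)
      omega
  · intro w hw
    exact (Finset.mem_filter.1 hw).2
  · have key : ∀ w ∈ NN G S U, k' ≤ (NN G S U ∩ nb G w).card := by
      intro w hw
      obtain ⟨hwSU, u, hu, huw⟩ := Finset.mem_filter.1 hw
      obtain ⟨hwS, hwU⟩ := Finset.mem_sdiff.1 hwSU
      have hnP : ¬ P (insert w U) := by
        intro hP
        have := hUmax _ (Finset.mem_filter.2 ⟨mem_univ _, hP⟩)
        rw [Finset.card_insert_of_notMem hwU] at this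
        omega
      have h1 : ¬ (k * ((S \ insert w U).card + 1) ≤ ee G (S \ insert w U) +
          2 * (NN G S (insert w U)).card) := fun h =>
        hnP ⟨Finset.insert_subset hwS hUS, Finset.insert_nonempty _ _,
          conn_insert G U hUc u w hu huw, h⟩
      have h2 : S \ insert w U = (S \ U).erase w := by
        ext z; simp only [mem_sdiff, mem_insert, mem_erase]; tauto
      rw [h2, Finset.card_erase_add_one hwSU] at h1
      have h3 := ee_erase G (S \ U) w hwSU
      have h4 : NN G S (insert w U) = (NN G S U).erase w ∪ ((S \ U ∩ nb G w) \ NN G S U) := NN_insert G S U w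
      have h5 : Disjoint ((NN G S U).erase w) ((S \ U ∩ nb G w) \ NN G S U) := by
        rw [Finset.disjoint_left]
        intro z hz hz2
        exact (Finset.mem_sdiff.1 hz2).2 (Finset.mem_of_mem_erase hz)
      have h6 := Finset.card_union_of_disjoint h5
      rw [← h4] at h6
      have h7 := Finset.card_erase_add_one hw
      have h8 : ((S \ U ∩ nb G w) \ NN G S U).card + (NN G S U ∩ nb G w).card =
          (S \ U ∩ nb G w).card := by
        rw [← Finset.card_sdiff_add_card_inter (S \ U ∩ nb G w) (NN G S U)]
        congr 2
        ext z
        simp only [mem_inter, mem_NN, mem_sdiff]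
        constructor
        · rintro ⟨⟨h, h'⟩, h''⟩
          exact ⟨⟨h, h''⟩, h, h'⟩
        · rintro ⟨⟨h, h''⟩, _, h'⟩
          exact ⟨⟨h, h'⟩, h''⟩
      rw [Nat.mul_add] at hUP
      omega
    unfold ee
    rw [mul_comm, ← smul_eq_mul]
    exact Finset.card_nsmul_le_sum _ _ _ key

theorem mader {VH : Type} [Fintype VH] (H : SimpleGraph VH) :
    ∃ k : ℕ, ∀ (V : Type) [Fintype V] (G : SimpleGraph V) (S : Finset V), S.Nonempty →
      k * S.card ≤ ee G S → SubIn H G (S : Set V) := by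
  induction H using WellFoundedLT.induction with
  | ind H ih =>
  by_cases hbot : H = ⊥
  · subst hbot
    refine ⟨Fintype.card VH, ?_⟩
    intro V _ G S hS hE
    have h1 : ee G S ≤ S.card * S.card := by
      unfold ee
      calc _ ≤ ∑ v ∈ S, S.card := Finset.sum_le_sum fun v _ =>
            Finset.card_le_card Finset.inter_subset_left
        _ = _ := by rw [Finset.sum_const, smul_eq_mul]
    have h2 : Fintype.card VH ≤ S.card := Nat.le_of_mul_le_mul_right (hE.trans h1) hS.card_pos
    have : Nonempty (VH ↪ S) := by
      apply Function.Embedding.nonempty_of_card_le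
      simpa using h2
    obtain ⟨f⟩ := this
    exact ⟨VH, ⊥, fun x => (f x : V), IsSubdivision.refl _,
      fun x y h => f.injective (Subtype.ext h), fun x y h => absurd h (by simp), fun x => (f x).2⟩
  · obtain ⟨x, y, hxy⟩ := SimpleGraph.ne_bot_iff_exists_adj.1 hbot
    let H' := H.deleteEdges {s(x, y)}
    have hxy' : ¬ H'.Adj x y := by simp [H']
    have hlt : H' < H := lt_of_le_of_ne (SimpleGraph.deleteEdges_le _)
      (fun h => hxy' (h ▸ hxy))
    have heq : H' ⊔ SimpleGraph.edge x y = H := by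
      ext a b
      simp only [H', SimpleGraph.sup_adj, SimpleGraph.deleteEdges_adj, SimpleGraph.edge_adj,
        Set.mem_singleton_iff, Sym2.eq_iff]
      constructor
      · rintro (h | ⟨⟨rfl, rfl⟩ | ⟨rfl, rfl⟩, _⟩)
        · exact h.1
        · exact hxy
        · exact hxy.symm
      · intro h
        by_cases h2 : (a = x ∧ b = y ∨ a = y ∧ b = x)
        · exact Or.inr ⟨h2, h.ne⟩
        · exact Or.inl ⟨h, h2⟩
    obtain ⟨k', hk'⟩ := ih H' hlt
    refine ⟨2 * k' + 2, ?_⟩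
    intro V _ G S hS hE
    obtain ⟨U, Y, hUS, hYS, hUY, hUc, hYne, hYU, hYE⟩ := mader_struct G k' S hS hE
    obtain ⟨W, T, f, hT, hf, hhom, hfY⟩ := hk' V G Y hYne hYE
    obtain ⟨ι, hι, hlift⟩ := lift_sub hT
    obtain ⟨hn, hsub⟩ := hlift x y hxy.ne hxy'
    rw [heq] at hsub
    obtain ⟨u, hu, huc⟩ := hYU _ (hfY (ι x))
    obtain ⟨v, hv, hvc⟩ := hYU _ (hfY (ι y))
    obtain ⟨p, hp⟩ := hUc u hu v hv
    let q : G.Walk (f (ι x)) (f (ι y)) :=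
      SimpleGraph.Walk.cons huc.symm (p.append (SimpleGraph.Walk.cons hvc SimpleGraph.Walk.nil))
    have hq : ∀ z ∈ q.support, z = f (ι x) ∨ z = f (ι y) ∨ z ∈ U := by
      intro z hz
      simp only [q, SimpleGraph.Walk.support_cons, List.mem_cons,
        SimpleGraph.Walk.mem_support_append_iff, SimpleGraph.Walk.support_nil,
        List.not_mem_nil, or_false] at hz
      rcases hz with h | h | h | h
      · exact Or.inl h
      · exact Or.inr (Or.inr (hp z h))
      · exact Or.inr (Or.inr (h ▸ hv))
      · exact Or.inr (Or.inl h)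
    have hq' : ∀ z ∈ q.bypass.support, z = f (ι x) ∨ z = f (ι y) ∨ z ∈ U :=
      fun z hz => hq z (SimpleGraph.Walk.support_bypass_subset_support q hz)
    refine path_ext (S : Set V) q.bypass (SimpleGraph.Walk.bypass_isPath q) ?_ W
      (T ⊔ SimpleGraph.edge (ι x) (ι y)) (ι x) (ι y) f hf ?_ rfl rfl ?_ ?_ ?_ hsub
    · intro z hz
      rcases hq' z hz with rfl | rfl | h
      · exact hYS (hfY _)
      · exact hYS (hfY _)
      · exact hUS h
    · right
      rw [SimpleGraph.edge_adj]
      exact ⟨Or.inl ⟨rfl, rfl⟩, fun e => hxy.ne (hι e)⟩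
    · intro a b hab hne
      rcases hab with hab | hab
      · exact hhom a b hab
      · rw [SimpleGraph.edge_adj] at hab
        exact absurd hab.1 (by tauto)
    · intro a
      exact hYS (hfY a)
    · rintro z hz ⟨a, rfl⟩
      rcases hq' _ hz with h | h | h
      · exact Or.inl h
      · exact Or.inr h
      · exact absurd (hfY a) (fun h2 => Finset.disjoint_left.1 hUY h h2)

end PolyProof
section PolyProof
open scoped Classical
open Finset
set_option linter.unusedSectionVars false

variable {V : Type} [Fintype V]

/-- an induced subdivision, embedding form -/
def IndSub {VH V : Type} (H : SimpleGraph VH) (G : SimpleGraph V) : Prop :=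
  ∃ (W : Type) (S : SimpleGraph W) (f : W → V), IsSubdivision H S ∧ Function.Injective f ∧
    ∀ x y, G.Adj (f x) (f y) ↔ S.Adj x y

lemma IndSub.has {VH V : Type} {H : SimpleGraph VH} {G : SimpleGraph V} (h : IndSub H G) :
    HasInducedSubdivision G H := by
  obtain ⟨W, S, f, hS, hf, hadj⟩ := h
  refine ⟨W, S, hS, Set.range f, ⟨⟨(Equiv.ofInjective f hf).symm, ?_⟩⟩⟩
  rintro ⟨_, x, rfl⟩ ⟨_, y, rfl⟩
  have h1 : ∀ z, (Equiv.ofInjective f hf).symm ⟨f z, z, rfl⟩ = z :=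
    fun z => Equiv.ofInjective_symm_apply hf z
  show S.Adj ((Equiv.ofInjective f hf).symm ⟨f x, x, rfl⟩)
    ((Equiv.ofInjective f hf).symm ⟨f y, y, rfl⟩) ↔ _
  rw [h1, h1]
  exact (hadj x y).symm

lemma finish_sub {VH : Type} {H : SimpleGraph VH} {G : SimpleGraph V} (A B : Finset V)
    (hA : ∀ a ∈ A, ∀ a' ∈ A, ¬ G.Adj a a') (hB : ∀ b ∈ B, ∀ b' ∈ B, ¬ G.Adj b b')
    (hAB : ∀ b ∈ B, b ∉ A)
    (htr : ∀ b ∈ B, ∀ u ∈ A, ∀ v ∈ A, u ≠ v → G.Adj b u → G.Adj b v → ∀ z ∈ A, G.Adj b z →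
      z = u ∨ z = v) (n : ℕ) :
    ∀ (W : Type) (S : SimpleGraph W) (f : W → V), IsSubdivision H S → Function.Injective f →
      (∀ x, f x ∈ A ∨ f x ∈ B) →
      (∀ x y, S.Adj x y → G.Adj (f x) (f y) ∨ (f x ∈ A ∧ f y ∈ A)) →
      (∀ x y, G.Adj (f x) (f y) → S.Adj x y) →
      (∀ x y, S.Adj x y → f x ∈ A → f y ∈ A →
        ∃ b ∈ B, G.Adj b (f x) ∧ G.Adj b (f y) ∧ ∀ z, f z ≠ b) →
      {q : W × W | S.Adj q.1 q.2 ∧ f q.1 ∈ A ∧ f q.2 ∈ A}.ncard ≤ n → IndSub H G := by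
  induction n with
  | zero =>
    intro W S f hS hf hr h1 h2 h3 hn
    have : Finite W := Finite.of_injective f hf
    have hemp : {q : W × W | S.Adj q.1 q.2 ∧ f q.1 ∈ A ∧ f q.2 ∈ A} = ∅ :=
      (Set.ncard_eq_zero (Set.toFinite _)).1 (by omega)
    refine ⟨W, S, f, hS, hf, fun x y => ⟨h2 x y, fun h => ?_⟩⟩
    rcases h1 x y h with h' | h'
    · exact h'
    · have : (x, y) ∈ {q : W × W | S.Adj q.1 q.2 ∧ f q.1 ∈ A ∧ f q.2 ∈ A} := ⟨h, h'⟩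
      rw [hemp] at this
      exact absurd this (Set.notMem_empty _)
  | succ n ih =>
    intro W S f hS hf hr h1 h2 h3 hn
    have : Finite W := Finite.of_injective f hf
    set T := {q : W × W | S.Adj q.1 q.2 ∧ f q.1 ∈ A ∧ f q.2 ∈ A} with hT
    rcases T.eq_empty_or_nonempty with hemp | ⟨⟨x, y⟩, hxyT⟩
    · refine ⟨W, S, f, hS, hf, fun x y => ⟨h2 x y, fun h => ?_⟩⟩
      rcases h1 x y h with h' | h'
      · exact h'
      · have : (x, y) ∈ T := ⟨h, h'⟩
        rw [hemp] at this
        exact absurd this (Set.notMem_empty _)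
    · obtain ⟨hxy, hxA, hyA⟩ := hxyT
      simp only at hxy hxA hyA
      obtain ⟨b, hb, hbx, hby, hbf⟩ := h3 x y hxy hxA hyA
      have hxyne : f x ≠ f y := fun e => hxy.ne (hf e)
      have hbtr : ∀ z, G.Adj b (f z) → z = x ∨ z = y := by
        intro z hz
        rcases hr z with h | h
        · rcases htr b hb _ hxA _ hyA hxyne hbx hby _ h hz with h' | h'
          · exact Or.inl (hf h')
          · exact Or.inr (hf h')
        · exact absurd hz (hB b hb _ h)
      refine ih (Option W) (edgeSubdiv S x y) (fun o => o.elim b f)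
        (IsSubdivision.step _ _ _ _ hS hxy) ?_ ?_ ?_ ?_ ?_ ?_
      · rintro (_ | z) (_ | w) h
        · rfl
        · exact absurd h.symm (hbf w)
        · exact absurd h (hbf z)
        · exact congrArg _ (hf h)
      · rintro (_ | z)
        · exact Or.inr hb
        · exact hr z
      · rintro (_ | z) (_ | w) h
        · exact absurd h (SimpleGraph.irrefl _)
        · left
          rcases edgeSubdiv_none.1 h with rfl | rfl
          · exact hbx
          · exact hby
        · left
          rcases edgeSubdiv_none'.1 h with rfl | rfl
          · exact hbx.symm
          · exact hby.symm
        · exact h1 z w (edgeSubdiv_some.1 h).1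
      · rintro (_ | z) (_ | w) h
        · exact absurd h (SimpleGraph.irrefl _)
        · exact edgeSubdiv_none.2 (hbtr w h)
        · exact edgeSubdiv_none'.2 (hbtr z (SimpleGraph.Adj.symm h))
        · refine edgeSubdiv_some.2 ⟨h2 z w h, ?_⟩
          rintro (⟨rfl, rfl⟩ | ⟨rfl, rfl⟩)
          · exact hA _ hxA _ hyA h
          · exact hA _ hyA _ hxA h
      · rintro (_ | z) (_ | w) h hz hw
        · exact absurd h (SimpleGraph.irrefl _)
        · exact absurd hz (hAB b hb)
        · exact absurd hw (hAB b hb)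
        · obtain ⟨hzw, hne⟩ := edgeSubdiv_some.1 h
          obtain ⟨b', hb', hb'z, hb'w, hb'f⟩ := h3 z w hzw hz hw
          refine ⟨b', hb', hb'z, hb'w, ?_⟩
          rintro (_ | t) e
          · have e' : b = b' := e
            rw [← e'] at hb'z hb'w
            have := hzw.ne
            rcases hbtr z hb'z with rfl | rfl <;> rcases hbtr w hb'w with rfl | rfl
            · exact this rfl
            · exact hne (Or.inl ⟨rfl, rfl⟩)
            · exact hne (Or.inr ⟨rfl, rfl⟩)
            · exact this rfl
          · exact hb'f t e
      · have hsub : {q : Option W × Option W | (edgeSubdiv S x y).Adj q.1 q.2 ∧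
            q.1.elim b f ∈ A ∧ q.2.elim b f ∈ A} ⊆
            (fun q : W × W => (some q.1, some q.2)) '' (T \ {(x, y)}) := by
          rintro ⟨_ | z, _ | w⟩ ⟨h, hz, hw⟩
          · exact absurd hz (hAB b hb)
          · exact absurd hz (hAB b hb)
          · exact absurd hw (hAB b hb)
          · obtain ⟨hzw, hne⟩ := edgeSubdiv_some.1 h
            refine ⟨(z, w), ⟨⟨hzw, hz, hw⟩, ?_⟩, rfl⟩
            intro e
            rw [Set.mem_singleton_iff, Prod.mk.injEq] at e
            exact hne (Or.inl e)
        have h4 := (Set.ncard_le_ncard hsub (Set.toFinite _)).trans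
          (Set.ncard_image_le (Set.toFinite _))
        have h5 : (T \ {(x, y)}).ncard < T.ncard :=
          Set.ncard_sdiff_singleton_lt_of_mem ⟨hxy, hxA, hyA⟩ (Set.toFinite _)
        exact h4.trans (by omega)

/-- the auxiliary graph on `A` -/
def auxG (G : SimpleGraph V) (A B : Finset V) : SimpleGraph V where
  Adj a a' := a ≠ a' ∧ a ∈ A ∧ a' ∈ A ∧ ∃ b ∈ B, G.Adj b a ∧ G.Adj b a'
  symm := ⟨by
    rintro a a' ⟨h, h1, h2, b, hb, h3, h4⟩
    exact ⟨h.symm, h2, h1, b, hb, h4, h3⟩⟩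
  loopless := ⟨fun a h => h.1 rfl⟩

lemma oneSub_win {VH : Type} {H : SimpleGraph VH} {k : ℕ}
    (hM : ∀ (V : Type) [Fintype V] (G : SimpleGraph V) (S : Finset V), S.Nonempty →
      k * S.card ≤ ee G S → SubIn H G (S : Set V))
    {G : SimpleGraph V} (h : OneSub G k) : IndSub H G := by
  obtain ⟨A, B, hAne, hA, hB, htr, hdist, hcard⟩ := h
  have htr' : ∀ b ∈ B, ∀ u ∈ A, ∀ v ∈ A, u ≠ v → G.Adj b u → G.Adj b v → ∀ z ∈ A, G.Adj b z →
      z = u ∨ z = v := by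
    intro b hb u hu v hv huv hbu hbv z hz hbz
    obtain ⟨a, ha, a', ha', haa, h⟩ := htr b hb
    have h1 := (h u hu).1 hbu
    have h2 := (h v hv).1 hbv
    have h3 := (h z hz).1 hbz
    grind
  have hAB : ∀ b ∈ B, b ∉ A := by
    intro b hb hbA
    obtain ⟨a, ha, a', ha', haa, h⟩ := htr b hb
    exact hA b hbA a ha ((h a ha).2 (Or.inl rfl))
  have hE : k * A.card ≤ ee (auxG G A B) A := by
    refine hcard.trans ?_
    have h1 : ee (auxG G A B) A = ((A ×ˢ A).filter fun q => (auxG G A B).Adj q.1 q.2).card := by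
      rw [Finset.card_filter, Finset.sum_product]
      unfold ee
      apply Finset.sum_congr rfl
      intro a _
      rw [← Finset.card_filter]
      congr 1
      ext z
      simp [mem_nb]
    rw [h1]
    have hch : ∀ b, ∃ q : V × V, b ∈ B → q.1 ∈ A ∧ q.2 ∈ A ∧ q.1 ≠ q.2 ∧
        ∀ z ∈ A, G.Adj b z ↔ (z = q.1 ∨ z = q.2) := by
      intro b
      by_cases hb : b ∈ B
      · obtain ⟨a, ha, a', ha', haa, h⟩ := htr b hb
        exact ⟨(a, a'), fun _ => ⟨ha, ha', haa, h⟩⟩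
      · exact ⟨(b, b), fun h => absurd h hb⟩
    choose pr hpr using hch
    apply Finset.card_le_card_of_injOn pr
    · intro b hb
      obtain ⟨q1, q2, q3, q4⟩ := hpr b hb
      simp only [Finset.coe_filter, Set.mem_ofPred_eq, Finset.mem_product]
      exact ⟨⟨q1, q2⟩, q3, q1, q2, b, hb, (q4 _ q1).2 (Or.inl rfl), (q4 _ q2).2 (Or.inr rfl)⟩
    · intro b hb b' hb' e
      obtain ⟨q1, q2, q3, q4⟩ := hpr b hb
      obtain ⟨r1, r2, r3, r4⟩ := hpr b' hb'
      apply hdist b hb b' hb'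
      intro z hz
      rw [q4 z hz, r4 z hz, e]
  obtain ⟨W, S, f, hS, hf, hhom, hfA⟩ := hM V (auxG G A B) A hAne hE
  refine finish_sub A B hA hB hAB htr' _ W S f hS hf (fun x => Or.inl (hfA x))
    (fun x y _ => Or.inr ⟨hfA x, hfA y⟩) (fun x y h => absurd h (hA _ (hfA x) _ (hfA y)))
    ?_ le_rfl
  intro x y hxy _ _
  obtain ⟨_, _, _, b, hb, h1, h2⟩ := hhom x y hxy
  exact ⟨b, hb, h1, h2, fun z e => hAB b hb (e ▸ hfA z)⟩

/-- polynomially expressible functions -/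
def IsP (f : ℕ → ℕ) : Prop := ∃ p : Polynomial ℝ, ∀ s : ℕ, p.eval (s : ℝ) = f s

lemma IsP.const (c : ℕ) : IsP (fun _ => c) := ⟨Polynomial.C (c : ℝ), by simp⟩
lemma IsP.id : IsP (fun s => s) := ⟨Polynomial.X, by simp⟩
lemma IsP.add {f g : ℕ → ℕ} (hf : IsP f) (hg : IsP g) : IsP (fun s => f s + g s) := by
  obtain ⟨p, hp⟩ := hf
  obtain ⟨q, hq⟩ := hg
  exact ⟨p + q, fun s => by simp [hp, hq]⟩
lemma IsP.mul {f g : ℕ → ℕ} (hf : IsP f) (hg : IsP g) : IsP (fun s => f s * g s) := by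
  obtain ⟨p, hp⟩ := hf
  obtain ⟨q, hq⟩ := hg
  exact ⟨p * q, fun s => by simp [hp, hq]⟩
lemma IsP.pow {f : ℕ → ℕ} (hf : IsP f) (n : ℕ) : IsP (fun s => f s ^ n) := by
  obtain ⟨p, hp⟩ := hf
  exact ⟨p ^ n, fun s => by simp [hp]⟩

lemma isP_RR (k : ℕ) : IsP (fun s => RR s k) :=
  (IsP.mul (IsP.const 4) IsP.id).pow _

lemma isP_MM (k : ℕ) : IsP (fun s => MM s k) := by
  have h2 : IsP (fun s => 2 * s) := IsP.mul (IsP.const 2) IsP.id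
  exact (h2.pow _).mul ((h2.pow _).mul (IsP.const _))

lemma isP_GG (k : ℕ) : IsP (fun s => GG s k) := by
  have h := isP_RR k
  exact (h.pow 2).add (((h.pow 3).mul ((h.add (IsP.const 1)).pow _)).mul IsP.id)

lemma isP_TT (k : ℕ) : IsP (fun s => TT s k) :=
  ((IsP.const (10 ^ 10)).mul ((isP_RR k).pow 4)).mul (IsP.const k)

lemma isP_DD (k : ℕ) : IsP (fun s => DD s k) := by
  have hT := isP_TT k
  have hG := isP_GG k
  have hM := isP_MM k
  have hR := isP_RR k
  exact ((hT.pow 4).mul ((((IsP.const 8).mul (hR.pow 2)).mul hM).add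
    ((IsP.const 16).mul (hG.pow 2)) |>.add (IsP.const 1))).add
    (((IsP.const 4).mul hG).add (IsP.const 1)) |>.add (hM.mul (hT.pow 2))

end PolyProof
section PolyProof
open scoped Classical
open Finset
set_option linter.unusedSectionVars false

variable {V : Type} [Fintype V]

/-- some nonempty set has minimum degree at least `d` -/
def MinDeg (G : SimpleGraph V) (d : ℕ) (S : Finset V) : Prop :=
  S.Nonempty ∧ ∀ v ∈ S, d ≤ (S ∩ nb G v).card

lemma exists_minDeg (G : SimpleGraph V) (D : ℕ) (h : 2 * D * Fintype.card V < ee G univ) :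
    ∃ S, MinDeg G D S := by
  let ok : Finset V → Prop := fun S => 2 * D * S.card < ee G S
  obtain ⟨S, hS, hmin⟩ := Finset.exists_min_image (univ.filter ok) Finset.card
    ⟨univ, by simpa [ok] using h⟩
  have hS' : 2 * D * S.card < ee G S := (Finset.mem_filter.1 hS).2
  refine ⟨S, ?_, ?_⟩
  · rw [Finset.nonempty_iff_ne_empty]
    rintro rfl
    simp [ee] at hS'
  · intro v hv
    by_contra hc
    push Not at hc
    have h1 := ee_erase G S v hv
    have h2 := Finset.card_erase_add_one hv
    have h3 : ok (S.erase v) := by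
      show 2 * D * (S.erase v).card < ee G (S.erase v)
      rw [← h2, Nat.mul_add] at hS'
      omega
    have := hmin _ (Finset.mem_filter.2 ⟨mem_univ _, h3⟩)
    omega

lemma exists_core (G : SimpleGraph V) (D : ℕ) (h : ∃ S, MinDeg G D S) :
    ∃ d S, D ≤ d ∧ MinDeg G d S ∧
      ∀ T : Finset V, T.Nonempty → ∃ v ∈ T, (T ∩ nb G v).card ≤ d := by
  have hbd : ∀ d, (∃ S, MinDeg G d S) → d ≤ Fintype.card V := by
    rintro d ⟨S, ⟨v, hv⟩, hS⟩
    exact (hS v hv).trans (Finset.card_le_univ _)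
  let d := Nat.findGreatest (fun d => ∃ S, MinDeg G d S) (Fintype.card V)
  have hd : ∃ S, MinDeg G d S := Nat.findGreatest_spec (P := fun d => ∃ S, MinDeg G d S)
    (hbd D h) h
  obtain ⟨S, hS⟩ := hd
  refine ⟨d, S, Nat.le_findGreatest (hbd D h) h, hS, ?_⟩
  intro T hT
  by_contra hc
  push Not at hc
  have h1 : ∃ S, MinDeg G (d + 1) S := ⟨T, hT, fun v hv => hc v hv⟩
  have := Nat.le_findGreatest (P := fun d => ∃ S, MinDeg G d S) (hbd _ h1) h1
  omega

lemma ee_univ (G : SimpleGraph V) : ee G univ = 2 * G.edgeSet.ncard := by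
  have h1 := G.sum_degrees_eq_twice_card_edges
  have h2 : G.edgeSet.ncard = G.edgeFinset.card := by
    rw [← SimpleGraph.coe_edgeFinset, Set.ncard_coe_finset]
  rw [h2, ← h1]
  unfold ee
  apply Finset.sum_congr rfl
  intro v _
  rw [Finset.univ_inter, ← SimpleGraph.card_neighborFinset_eq_degree]
  congr 1
  ext z
  simp [mem_nb]

lemma final_step {VH : Type} {H : SimpleGraph VH} {k s : ℕ} (hk : 0 < k) (hs : 0 < s)
    (hM : ∀ (V : Type) [Fintype V] (G : SimpleGraph V) (S : Finset V), S.Nonempty →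
      k * S.card ≤ ee G S → SubIn H G (S : Set V))
    (G : SimpleGraph V) (hK : KFree s G) (hE : 2 * DD s k * Fintype.card V < ee G univ) :
    IndSub H G := by
  obtain ⟨d, S, hDd, ⟨hSne, hSmin⟩, hdeg⟩ := exists_core G _ (exists_minDeg G _ hE)
  let G' : SimpleGraph S := G.comap Subtype.val
  let em : S ↪ V := Function.Embedding.subtype _
  have hnb : ∀ (T : Finset S) (v : S), ((T.map em) ∩ nb G v).card = (T ∩ nb G' v).card := by
    intro T v
    rw [← Finset.card_map em]
    congr 1
    ext z
    simp only [mem_inter, mem_map, mem_nb, em, Function.Embedding.subtype_apply, G',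
      SimpleGraph.comap_adj]
    constructor
    · rintro ⟨⟨a, ha, rfl⟩, h⟩
      exact ⟨a, ⟨ha, h⟩, rfl⟩
    · rintro ⟨a, ⟨ha, h⟩, rfl⟩
      exact ⟨⟨a, ha, rfl⟩, h⟩
  have hK' : KFree s G' := by
    intro P Q hP hQ hPQ
    refine hK (P.map em) (Q.map em) (by rw [Finset.card_map, hP]) (by rw [Finset.card_map, hQ]) ?_
    intro x hx y hy
    obtain ⟨x', hx', rfl⟩ := Finset.mem_map.1 hx
    obtain ⟨y', hy', rfl⟩ := Finset.mem_map.1 hy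
    exact hPQ x' hx' y' hy'
  have huniv : (univ : Finset S).map em = S := by
    ext z
    simp [em]
  have hcore : OneSub G' k := by
    refine core hs hk hK' ?_ d hDd ?_ ?_
    · rw [Fintype.card_coe]; exact hSne.card_pos
    · intro v
      have h1 := hnb univ v
      rw [huniv, Finset.univ_inter] at h1
      rw [← h1]
      exact hSmin v v.2
    · intro T hT
      obtain ⟨v, hv, hvd⟩ := hdeg (T.map em) (hT.map)
      obtain ⟨v', hv', rfl⟩ := Finset.mem_map.1 hv
      refine ⟨v', hv', ?_⟩
      have h2 := Nat.le_trans (Nat.le_of_eq (hnb T v').symm) hvd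
      convert h2
  obtain ⟨W, T, f, hT, hf, hadj⟩ := oneSub_win hM hcore
  exact ⟨W, T, fun x => (f x : V), hT, fun x y h => hf (Subtype.ext h), hadj⟩

end PolyProof

theorem stmt_0 {VH : Type} [Fintype VH] (H : SimpleGraph VH) :
    ∃ p : Polynomial ℝ, ∀ s : ℕ, 0 < s →
      ∀ (V : Type) [Fintype V], ∀ G : SimpleGraph V,
        ¬ HasSubgraphCopy G (completeBipartiteGraph (Fin s) (Fin s)) →
        ¬ HasInducedSubdivision G H →
        avgDeg G ≤ p.eval (s : ℝ) := by
  obtain ⟨k0, hk0⟩ := mader H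
  have hM : ∀ (V : Type) [Fintype V] (G : SimpleGraph V) (S : Finset V), S.Nonempty →
      (k0 + 1) * S.card ≤ ee G S → SubIn H G (S : Set V) := by
    intro V _ G S hS hE
    exact hk0 V G S hS (le_trans (Nat.mul_le_mul_right _ (Nat.le_succ k0)) hE)
  obtain ⟨p, hp⟩ := (IsP.const 2).mul (isP_DD (k0 + 1))
  refine ⟨p, ?_⟩
  intro s hs V _ G hK hI
  rw [hp s]
  by_contra hcon
  push Not at hcon
  have hn : 0 < Fintype.card V := by
    rcases Nat.eq_zero_or_pos (Fintype.card V) with h | h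
    · exfalso
      unfold avgDeg at hcon
      rw [h] at hcon
      simp only [Nat.cast_zero, div_zero] at hcon
      exact absurd hcon (not_lt.2 (Nat.cast_nonneg _))
    · exact h
  have hn' : (0 : ℝ) < Fintype.card V := by exact_mod_cast hn
  unfold avgDeg at hcon
  rw [lt_div_iff₀ hn'] at hcon
  apply hI
  refine (final_step (Nat.succ_pos k0) hs hM G (kfree_of_not_copy hK) ?_).has
  rw [ee_univ]
  exact_mod_cast hcon
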